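/- arXiv:0804.4302 — 5 statements merged into one kernel-verified Lean document; each statement's English description precedes it below -/
import Mathlib

section
/- There is a universal constant C > 0 with the following property. Let a ≥ b > 0, let S = {(x, y, z) ∈ ℝ³ : x²/a² + (y² + z²)/b² = 1} be the ellipsoid of revolution with semiaxes a, b, and let B ⊂ ℝ³ be a closed ball of radius R centered at the focus (√(a² − b²), 0, 0), where b²/a ≤ R ≤ a. Let δ > 0 and let P = {x ∈ ℝ³ : t ≤ x·n ≤ t + δ} be any δ-thickened plane (n ∈ ℝ³ a unit vector, t ∈ ℝ). Then μH²(S ∩ B ∩ P) ≤ C·R·δ, where μH² denotes the 2-dimensional Hausdorff measure on ℝ³. -/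
open MeasureTheory Set
open scoped ENNReal InnerProductSpace

noncomputable section

abbrev E3 : Type := EuclideanSpace ℝ (Fin 3)

/-- If a map expands distances on `X` up to the factor `K`, the Hausdorff measure of `X` is
controlled by that of its image. -/
lemma hausdorffMeasure_le_of_antilipschitzOn {E F : Type*} [MetricSpace E] [MeasurableSpace E]
    [BorelSpace E] [MetricSpace F] [MeasurableSpace F] [BorelSpace F] {d : ℝ} (hd : 0 ≤ d)
    {K : NNReal} {f : E → F} {X : Set E}
    (h : ∀ x ∈ X, ∀ y ∈ X, dist x y ≤ K * dist (f x) (f y)) :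
    μH[d] X ≤ (K : ℝ≥0∞) ^ d * μH[d] (f '' X) := by
  have hA : AntilipschitzWith K (fun x : X => f x) :=
    AntilipschitzWith.of_le_mul_dist fun x y => h x x.2 y y.2
  have h1 := hA.le_hausdorffMeasure_image hd (univ : Set X)
  have h2 := (isometry_subtype_coe (s := X)).hausdorffMeasure_image (d := d) (Or.inl hd) univ
  have h3 : (fun x : X => f x) '' univ = f '' X := by
    ext y; simp
  rw [image_univ, Subtype.range_coe] at h2
  rw [h2]
  rwa [h3] at h1

/-- On the part of the quadric `∑ k i * x i ^ 2 = 1` where the `i`-th component of the normal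
dominates, the `i`-th coordinate is a Lipschitz function of the two others. -/
lemma abs_sub_le_of_normal_dominant {k₀ k₁ k₂ x₀ x₁ x₂ y₀ y₁ y₂ : ℝ}
    (hk₀ : 0 < k₀) (hk₁ : 0 < k₁) (hk₂ : 0 < k₂)
    (hx : k₀ * x₀ ^ 2 + k₁ * x₁ ^ 2 + k₂ * x₂ ^ 2 = 1)
    (hy : k₀ * y₀ ^ 2 + k₁ * y₁ ^ 2 + k₂ * y₂ ^ 2 = 1)
    (hx₁ : |k₁ * x₁| ≤ k₀ * x₀) (hx₂ : |k₂ * x₂| ≤ k₀ * x₀)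
    (hy₁ : |k₁ * y₁| ≤ k₀ * y₀) (hy₂ : |k₂ * y₂| ≤ k₀ * y₀) :
    |x₀ - y₀| ≤ |x₁ - y₁| + |x₂ - y₂| := by
  have aux : ∀ {x₀ x₁ x₂ y₀ y₁ y₂ : ℝ}, k₀ * x₀ ^ 2 + k₁ * x₁ ^ 2 + k₂ * x₂ ^ 2 = 1 →
      k₀ * y₀ ^ 2 + k₁ * y₁ ^ 2 + k₂ * y₂ ^ 2 = 1 →
      |k₁ * x₁| ≤ k₀ * x₀ → |k₂ * x₂| ≤ k₀ * x₀ →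
      y₀ - x₀ ≤ |x₁ - y₁| + |x₂ - y₂| := by
    intro x₀ x₁ x₂ y₀ y₁ y₂ hx hy h₁ h₂
    have hpos : 0 < k₀ * x₀ := by
      rcases (abs_nonneg (k₁ * x₁)).trans h₁ |>.lt_or_eq with h | h
      · exact h
      · rw [← h] at h₁ h₂
        have e₁ : x₁ = 0 := by
          simpa [hk₁.ne'] using abs_nonpos_iff.1 h₁
        have e₂ : x₂ = 0 := by
          simpa [hk₂.ne'] using abs_nonpos_iff.1 h₂
        have e₀ : x₀ = 0 := by
          simpa [hk₀.ne'] using h.symm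
        simp [e₀, e₁, e₂] at hx
    have hsup : k₀ * x₀ * (y₀ - x₀) ≤ -(k₁ * x₁ * (y₁ - x₁)) - k₂ * x₂ * (y₂ - x₂) := by
      nlinarith [mul_nonneg hk₀.le (sq_nonneg (x₀ - y₀)), mul_nonneg hk₁.le (sq_nonneg (x₁ - y₁)),
        mul_nonneg hk₂.le (sq_nonneg (x₂ - y₂))]
    have b₁ : -(k₁ * x₁ * (y₁ - x₁)) ≤ k₀ * x₀ * |x₁ - y₁| := by
      calc -(k₁ * x₁ * (y₁ - x₁)) ≤ |k₁ * x₁ * (x₁ - y₁)| :=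
            le_trans (by linarith) (le_abs_self _)
        _ ≤ _ := by rw [abs_mul]; gcongr
    have b₂ : -(k₂ * x₂ * (y₂ - x₂)) ≤ k₀ * x₀ * |x₂ - y₂| := by
      calc -(k₂ * x₂ * (y₂ - x₂)) ≤ |k₂ * x₂ * (x₂ - y₂)| :=
            le_trans (by linarith) (le_abs_self _)
        _ ≤ _ := by rw [abs_mul]; gcongr
    refine le_of_mul_le_mul_left ?_ hpos
    linarith
  rw [abs_le]
  have h := aux hx hy hx₁ hx₂
  have h' := aux hy hx hy₁ hy₂
  rw [abs_sub_comm y₁, abs_sub_comm y₂] at h'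
  constructor <;> linarith

/-- The coordinate projection of `ℝ³` onto the `(i, j)`-plane. -/
def coordPair (i j : Fin 3) (x : E3) : ℝ × ℝ := (x i, x j)

/-- A piece of a quadric whose normal points mostly in the direction `ε • e i` has area at most
`9` times the area of its projection along `e i`. -/
lemma hausdorffMeasure_le_of_normal_dominant {k : Fin 3 → ℝ} (hk : ∀ i, 0 < k i)
    (i j l : Fin 3) (hs : ∀ f : Fin 3 → ℝ, ∑ r, f r = f i + f j + f l)
    {ε : ℝ} (hε : |ε| = 1) {X : Set E3} (hX : ∀ x ∈ X, ∑ r, k r * x r ^ 2 = 1)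
    (hj : ∀ x ∈ X, |k j * x j| ≤ ε * (k i * x i))
    (hl : ∀ x ∈ X, |k l * x l| ≤ ε * (k i * x i)) :
    μH[2] X ≤ 9 * volume (coordPair j l '' X) := by
  have key := hausdorffMeasure_le_of_antilipschitzOn (d := 2) (by norm_num) (K := 3)
    (f := coordPair j l) (X := X) (by
      intro x hx y hy
      have hε2 : ε ^ 2 = 1 := by rw [← sq_abs, hε, one_pow]
      have h := abs_sub_le_of_normal_dominant (x₀ := ε * x i) (y₀ := ε * y i)
        (x₁ := x j) (y₁ := y j) (x₂ := x l) (y₂ := y l) (hk i) (hk j) (hk l)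
        (by rw [mul_pow, hε2, one_mul]; exact (hs _).symm.trans (hX x hx))
        (by rw [mul_pow, hε2, one_mul]; exact (hs _).symm.trans (hX y hy))
        ((hj x hx).trans_eq (by ring)) ((hl x hx).trans_eq (by ring))
        ((hj y hy).trans_eq (by ring)) ((hl y hy).trans_eq (by ring))
      rw [← mul_sub, abs_mul, hε, one_mul] at h
      have hdj : |x j - y j| ≤ dist (coordPair j l x) (coordPair j l y) := by
        rw [Prod.dist_eq]; exact le_max_left _ _
      have hdl : |x l - y l| ≤ dist (coordPair j l x) (coordPair j l y) := by
        rw [Prod.dist_eq]; exact le_max_right _ _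
      set D := dist (coordPair j l x) (coordPair j l y)
      have hD : 0 ≤ D := dist_nonneg
      rw [EuclideanSpace.dist_eq, hs]
      simp only [Real.dist_eq]
      refine Real.sqrt_le_iff.2 ⟨by positivity, ?_⟩
      have hi : |x i - y i| ≤ 2 * D := by linarith
      have q₁ := pow_le_pow_left₀ (abs_nonneg _) hi 2
      have q₂ := pow_le_pow_left₀ (abs_nonneg _) hdj 2
      have q₃ := pow_le_pow_left₀ (abs_nonneg _) hdl 2
      simp only [NNReal.coe_ofNat]
      nlinarith)
  rw [hausdorffMeasure_prod_real] at key
  refine key.trans_eq ?_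
  norm_num

/-- The area of a subset of an ellipsoid with axes along the coordinate axes is controlled by the
areas of its three coordinate projections. -/
lemma hausdorffMeasure_le_coordPair {k : Fin 3 → ℝ} (hk : ∀ i, 0 < k i) {X : Set E3}
    (hX : ∀ x ∈ X, ∑ r, k r * x r ^ 2 = 1) {V : ℝ≥0∞}
    (h₀ : volume (coordPair 1 2 '' X) ≤ V) (h₁ : volume (coordPair 0 2 '' X) ≤ V)
    (h₂ : volume (coordPair 0 1 '' X) ≤ V) :
    μH[2] X ≤ 54 * V := by
  let T : Fin 3 → ℝ → Set E3 := fun i ε => {x ∈ X | ∀ r, |k r * x r| ≤ ε * (k i * x i)}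
  have hT : ∀ (i j l : Fin 3), (∀ f : Fin 3 → ℝ, ∑ r, f r = f i + f j + f l) →
      volume (coordPair j l '' X) ≤ V → ∀ ε : ℝ, |ε| = 1 → μH[2] (T i ε) ≤ 9 * V := by
    intro i j l hs hV ε hε
    refine (hausdorffMeasure_le_of_normal_dominant hk i j l hs hε (fun x hx => hX x hx.1)
      (fun x hx => hx.2 j) (fun x hx => hx.2 l)).trans ?_
    gcongr
    exact (measure_mono (image_mono (sep_subset _ _))).trans hV
  have hs₀ : ∀ f : Fin 3 → ℝ, ∑ r, f r = f 0 + f 1 + f 2 := Fin.sum_univ_three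
  have hs₁ : ∀ f : Fin 3 → ℝ, ∑ r, f r = f 1 + f 0 + f 2 := fun f => by rw [hs₀]; ring
  have hs₂ : ∀ f : Fin 3 → ℝ, ∑ r, f r = f 2 + f 0 + f 1 := fun f => by rw [hs₀]; ring
  have hTi : ∀ i, μH[2] (T i 1 ∪ T i (-1)) ≤ 18 * V := by
    intro i
    have : ∀ ε : ℝ, |ε| = 1 → μH[2] (T i ε) ≤ 9 * V := by
      fin_cases i
      · exact hT 0 1 2 hs₀ h₀
      · exact hT 1 0 2 hs₁ h₁
      · exact hT 2 0 1 hs₂ h₂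
    refine (measure_union_le _ _).trans ((add_le_add (this 1 (by simp))
      (this (-1) (by simp))).trans_eq ?_)
    rw [← add_mul]; norm_num
  have hcover : X ⊆ ⋃ i, (T i 1 ∪ T i (-1)) := by
    intro x hx
    obtain ⟨i, hi⟩ := Finite.exists_max fun r => |k r * x r|
    refine mem_iUnion.2 ⟨i, ?_⟩
    rcases abs_cases (k i * x i) with h | h
    · left
      exact ⟨hx, fun r => (hi r).trans_eq (by rw [h.1, one_mul])⟩
    · right
      exact ⟨hx, fun r => (hi r).trans_eq (by rw [h.1, neg_one_mul])⟩
  refine (measure_mono hcover).trans ((measure_iUnion_fintype_le _ _).trans ?_)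
  refine (Finset.sum_le_sum fun i _ => hTi i).trans_eq ?_
  rw [Finset.sum_const, Finset.card_univ, Fintype.card_fin, nsmul_eq_mul, ← mul_assoc]
  norm_num

/-- One coordinate of the point with height `z.1` and longitude `z.2` on the unit sphere, relative
to an orthonormal frame whose axis, first and second equatorial vectors have coordinates
`m`, `p`, `q`. -/
def sphereCoord (m p q : ℝ) (z : ℝ × ℝ) : ℝ :=
  z.1 * m + √(1 - z.1 ^ 2) * (Real.cos z.2 * p + Real.sin z.2 * q)

lemma measurable_sphereCoord (m p q : ℝ) : Measurable (sphereCoord m p q) := by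
  unfold sphereCoord
  fun_prop

lemma hasFDerivAt_sphereCoord (m p q : ℝ) {z : ℝ × ℝ} (hz : 0 < 1 - z.1 ^ 2) :
    HasFDerivAt (sphereCoord m p q)
      ((m - z.1 / √(1 - z.1 ^ 2) * (Real.cos z.2 * p + Real.sin z.2 * q)) •
          ContinuousLinearMap.fst ℝ ℝ ℝ +
        (√(1 - z.1 ^ 2) * (Real.cos z.2 * q - Real.sin z.2 * p)) •
          ContinuousLinearMap.snd ℝ ℝ ℝ) z := by
  have h1 : HasFDerivAt (fun y : ℝ × ℝ => y.1) (ContinuousLinearMap.fst ℝ ℝ ℝ) z :=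
    hasFDerivAt_fst
  have h2 : HasFDerivAt (fun y : ℝ × ℝ => y.2) (ContinuousLinearMap.snd ℝ ℝ ℝ) z :=
    hasFDerivAt_snd
  have h := (h1.mul_const m).add ((((h1.pow 2).const_sub 1).sqrt hz.ne').mul
    (((Real.hasDerivAt_cos z.2).comp_hasFDerivAt z h2 |>.mul_const p).add
      ((Real.hasDerivAt_sin z.2).comp_hasFDerivAt z h2 |>.mul_const q)))
  refine h.congr_fderiv ?_
  have hs : √(1 - z.1 ^ 2) ≠ 0 := (Real.sqrt_pos.2 hz).ne'
  ext
  · simp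
    field_simp
    ring
  · simp
    ring

/-- The Jacobian determinant of two coordinates of a linear image of the unit sphere, in
height-longitude coordinates, is up to sign a multiple of the third coordinate. -/
lemma volume_sphereCoord_image_le {α β ε m₀ p₀ q₀ m₁ p₁ q₁ m₂ p₂ q₂ L w K t : ℝ}
    (hα : 0 ≤ α) (hβ : 0 ≤ β) (hL : 0 ≤ L) (hw : 0 ≤ w) (hε : |ε| = 1)
    (hm : p₀ * q₁ - p₁ * q₀ = ε * m₂) (hq : m₀ * p₁ - m₁ * p₀ = ε * q₂)
    (hp : m₀ * q₁ - m₁ * q₀ = -ε * p₂) :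
    volume ((fun z => (α * sphereCoord m₀ p₀ q₀ z, β * sphereCoord m₁ p₁ q₁ z)) ''
      {z : ℝ × ℝ | z ∈ Icc t (t + w) ×ˢ Icc (-K) K ∧ 0 < 1 - z.1 ^ 2 ∧
        |sphereCoord m₂ p₂ q₂ z| ≤ L}) ≤ ENNReal.ofReal (α * β * L * (w * (2 * K))) := by
  set D : Set (ℝ × ℝ) := {z | z ∈ Icc t (t + w) ×ˢ Icc (-K) K ∧ 0 < 1 - z.1 ^ 2 ∧
        |sphereCoord m₂ p₂ q₂ z| ≤ L}
  have hDm : MeasurableSet D := by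
    refine (measurableSet_Icc.prod measurableSet_Icc).inter (MeasurableSet.inter ?_ ?_)
    · exact measurableSet_lt measurable_const (measurable_const.sub (measurable_fst.pow_const 2))
    · exact measurableSet_le (measurable_sphereCoord _ _ _).abs measurable_const
  let A : ℝ × ℝ → ℝ × ℝ →L[ℝ] ℝ × ℝ := fun z =>
    (Matrix.toLin (.finTwoProd ℝ) (.finTwoProd ℝ)
      !![α * (m₀ - z.1 / √(1 - z.1 ^ 2) * (Real.cos z.2 * p₀ + Real.sin z.2 * q₀)),
          α * (√(1 - z.1 ^ 2) * (Real.cos z.2 * q₀ - Real.sin z.2 * p₀));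
        β * (m₁ - z.1 / √(1 - z.1 ^ 2) * (Real.cos z.2 * p₁ + Real.sin z.2 * q₁)),
          β * (√(1 - z.1 ^ 2) * (Real.cos z.2 * q₁ - Real.sin z.2 * p₁))]).toContinuousLinearMap
  have hderiv : ∀ z ∈ D, HasFDerivWithinAt
      (fun z => (α * sphereCoord m₀ p₀ q₀ z, β * sphereCoord m₁ p₁ q₁ z)) (A z) D z := by
    intro z hz
    have h := ((hasFDerivAt_sphereCoord m₀ p₀ q₀ hz.2.1).const_mul α).prodMk
      ((hasFDerivAt_sphereCoord m₁ p₁ q₁ hz.2.1).const_mul β)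
    refine (h.congr_fderiv ?_).hasFDerivWithinAt
    simp only [A]
    rw [Matrix.toLin_finTwoProd_toContinuousLinearMap]
    ext <;> simp
  have hdet : ∀ z ∈ D, |(A z).det| ≤ α * β * L := by
    intro z hz
    have hs : √(1 - z.1 ^ 2) ≠ 0 := (Real.sqrt_pos.2 hz.2.1).ne'
    have : (A z).det = -(α * β * ε * sphereCoord m₂ p₂ q₂ z) := by
      simp only [A, LinearMap.det_toContinuousLinearMap, LinearMap.det_toLin,
        Matrix.det_fin_two_of, sphereCoord]
      have hcs := Real.sin_sq_add_cos_sq z.2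
      set s := √(1 - z.1 ^ 2)
      set c := Real.cos z.2
      set d := Real.sin z.2
      have hinv : z.1 / s * s = z.1 := div_mul_cancel₀ _ hs
      set r := z.1 / s
      rw [← hinv]
      linear_combination α * β * s * (c * hp - d * hq) - α * β * r * s * (c ^ 2 + d ^ 2) * hm
        - α * β * r * s * ε * m₂ * hcs
    rw [this, abs_neg, abs_mul, abs_mul, hε, mul_one, abs_of_nonneg (mul_nonneg hα hβ)]
    exact mul_le_mul_of_nonneg_left hz.2.2 (mul_nonneg hα hβ)
  calc _ ≤ ∫⁻ z in D, ENNReal.ofReal |(A z).det| :=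
        addHaar_image_le_lintegral_abs_det_fderiv volume hDm hderiv
    _ ≤ ∫⁻ _ in D, ENNReal.ofReal (α * β * L) :=
        setLIntegral_mono' hDm fun z hz => ENNReal.ofReal_le_ofReal (hdet z hz)
    _ = ENNReal.ofReal (α * β * L) * volume D := setLIntegral_const _ _
    _ ≤ ENNReal.ofReal (α * β * L) * volume (Icc t (t + w) ×ˢ Icc (-K) K) := by
        gcongr; exact fun z hz => hz.1
    _ = _ := by
        rw [Measure.volume_eq_prod, Measure.prod_prod, Real.volume_Icc, Real.volume_Icc,
          add_sub_cancel_left, sub_neg_eq_add, ← two_mul,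
          ENNReal.ofReal_mul (by positivity : 0 ≤ α * β * L), ENNReal.ofReal_mul hw]

/-- Every point of the unit sphere has height-longitude coordinates. -/
lemma exists_sphereCoord {c d w₁ w₂ u₀ u₁ u₂ : ℝ} (hcd : c ^ 2 + d ^ 2 = 1)
    (hw : w₁ ^ 2 + w₂ ^ 2 = 1) (hu : u₀ ^ 2 + u₁ ^ 2 + u₂ ^ 2 = 1) :
    ∃ φ : ℝ, |φ| ≤ Real.pi ∧
      sphereCoord c d 0 (c * u₀ + d * w₁ * u₁ + d * w₂ * u₂, φ) = u₀ ∧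
      sphereCoord (d * w₁) (-c * w₁) (-w₂) (c * u₀ + d * w₁ * u₁ + d * w₂ * u₂, φ) = u₁ ∧
      sphereCoord (d * w₂) (-c * w₂) w₁ (c * u₀ + d * w₁ * u₁ + d * w₂ * u₂, φ) = u₂ := by
  set s := c * u₀ + d * w₁ * u₁ + d * w₂ * u₂ with hsdef
  set P := d * u₀ - c * w₁ * u₁ - c * w₂ * u₂ with hP
  set Q := -w₂ * u₁ + w₁ * u₂ with hQ
  have hPQ : P ^ 2 + Q ^ 2 = 1 - s ^ 2 := by
    rw [hP, hQ, hsdef]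
    linear_combination hu + (u₀ ^ 2 + (w₁ * u₁ + w₂ * u₂) ^ 2) * hcd
      + (u₁ ^ 2 + u₂ ^ 2) * hw
  have hnorm : ‖(⟨P, Q⟩ : ℂ)‖ = √(1 - s ^ 2) := by
    rw [← hPQ, Complex.norm_eq_sqrt_sq_add_sq]
  have hre := Complex.norm_mul_cos_arg (⟨P, Q⟩ : ℂ)
  have him := Complex.norm_mul_sin_arg (⟨P, Q⟩ : ℂ)
  rw [hnorm] at hre him
  refine ⟨Complex.arg ⟨P, Q⟩, Complex.abs_arg_le_pi _, ?_, ?_, ?_⟩ <;>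
    simp only [sphereCoord]
  · simp only [hP, hQ, hsdef] at *
    linear_combination d * hre + u₀ * hcd
  · simp only [hP, hQ, hsdef] at *
    linear_combination -c * w₁ * hre - w₂ * him + w₁ * (w₁ * u₁ + w₂ * u₂) * hcd + u₁ * hw
  · simp only [hP, hQ, hsdef] at *
    linear_combination -c * w₂ * hre + w₁ * him + w₂ * (w₁ * u₁ + w₂ * u₂) * hcd + u₂ * hw

/-- A point of the spherical cap `1 - τ ≤ u₀` has longitude at most of order `√τ / d` when the
axis makes an angle with sine `d` with the direction of the cap. -/
lemma sq_longitude_le {c d s φ τ : ℝ} (hcd : c ^ 2 + d ^ 2 = 1) (hd : 0 ≤ d)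
    (hs : 0 ≤ 1 - s ^ 2) (hφ : |φ| ≤ Real.pi) (hτ : 1 - τ ≤ sphereCoord c d 0 (s, φ)) :
    (d * φ) ^ 2 ≤ 2 * Real.pi ^ 2 * τ := by
  have hcos := Real.cos_le_one_sub_mul_cos_sq hφ
  have hpi := Real.pi_pos
  set k := 2 / Real.pi ^ 2 * φ ^ 2 with hk
  have hk0 : 0 ≤ k := by positivity
  have hφ2 : φ ^ 2 ≤ Real.pi ^ 2 := by
    rw [← sq_abs]; exact pow_le_pow_left₀ (abs_nonneg _) hφ 2
  have hkφ : Real.pi ^ 2 * k = 2 * φ ^ 2 := by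
    rw [hk]; field_simp
  have hk2 : k ≤ 2 := by
    have : 0 < Real.pi ^ 2 := by positivity
    nlinarith
  simp only [sphereCoord, mul_zero, add_zero] at hτ
  have hσ := Real.sq_sqrt hs
  have hσ0 := Real.sqrt_nonneg (1 - s ^ 2)
  set σ := √(1 - s ^ 2)
  have h1 : σ * d * k ≤ σ * d * (1 - Real.cos φ) :=
    mul_le_mul_of_nonneg_left (by linarith) (mul_nonneg hσ0 hd)
  have h2 : k * (σ - d) ^ 2 ≤ 2 * (σ - d) ^ 2 := mul_le_mul_of_nonneg_right hk2 (sq_nonneg _)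
  have h3 : k * d ^ 2 ≤ 4 * τ := by
    nlinarith [sq_nonneg (s - c), mul_nonneg hk0 (sq_nonneg σ), mul_nonneg hk0 (mul_nonneg hσ0 hd)]
  nlinarith [mul_le_mul_of_nonneg_left h3 (sq_nonneg Real.pi)]

/-- A set lying on a linear image of a height-longitude box of the unit sphere has projected area
controlled by the area of the box. -/
lemma volume_coordPair_image_le {α β ε m₀ p₀ q₀ m₁ p₁ q₁ m₂ p₂ q₂ L w K t : ℝ}
    (hα : 0 ≤ α) (hβ : 0 ≤ β) (hL : 0 ≤ L) (hw : 0 ≤ w) (hε : |ε| = 1)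
    (hm : p₀ * q₁ - p₁ * q₀ = ε * m₂) (hq : m₀ * p₁ - m₁ * p₀ = ε * q₂)
    (hp : m₀ * q₁ - m₁ * q₀ = -ε * p₂) {i j : Fin 3} {X : Set E3}
    (hX : ∀ x ∈ X, ∃ z ∈ Icc t (t + w) ×ˢ Icc (-K) K, 0 ≤ 1 - z.1 ^ 2 ∧
      |sphereCoord m₂ p₂ q₂ z| ≤ L ∧ x i = α * sphereCoord m₀ p₀ q₀ z ∧
      x j = β * sphereCoord m₁ p₁ q₁ z) :
    volume (coordPair i j '' X) ≤ ENNReal.ofReal (α * β * L * (w * (2 * K))) := by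
  refine le_trans ?_ (volume_sphereCoord_image_le (t := t) hα hβ hL hw hε hm hq hp)
  have hpoles : volume ({(α * m₀, β * m₁), (-(α * m₀), -(β * m₁))} : Set (ℝ × ℝ)) = 0 :=
    (Set.toFinite _).measure_zero _
  refine le_trans ?_ ((congrArg (volume _ + ·) hpoles).trans (add_zero _)).le
  refine (measure_mono ?_).trans (measure_union_le _ _)
  rintro _ ⟨x, hx, rfl⟩
  obtain ⟨z, hz, hz1, hzL, hi, hj⟩ := hX x hx
  rcases hz1.lt_or_eq with h | h
  · exact Or.inl ⟨z, ⟨hz, h, hzL⟩, by rw [coordPair, hi, hj]⟩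
  · right
    rw [coordPair, hi, hj, sphereCoord, sphereCoord, ← h, Real.sqrt_zero]
    rcases eq_or_eq_neg_of_sq_eq_sq z.1 1 (by linarith) with h | h <;> simp [h]

/-- The points of an ellipsoid of revolution within distance `R ≤ a` of a focus lie near the
corresponding vertex. -/
lemma cap_of_mem_closedBall_focus {a b R : ℝ} {x : E3} (hb : 0 < b) (hba : b ≤ a)
    (hR0 : 0 ≤ R) (hR : R ≤ a)
    (hS : (x 0) ^ 2 / a ^ 2 + ((x 1) ^ 2 + (x 2) ^ 2) / b ^ 2 = 1)
    (hB : x ∈ Metric.closedBall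
      ((WithLp.equiv 2 ((i : Fin 3) → ℝ)).symm ![Real.sqrt (a ^ 2 - b ^ 2), 0, 0]) R) :
    a - 2 * R ≤ x 0 := by
  have ha : 0 < a := hb.trans_le hba
  have hab : b ^ 2 ≤ a ^ 2 := pow_le_pow_left₀ hb.le hba 2
  have hc : 0 ≤ √(a ^ 2 - b ^ 2) := Real.sqrt_nonneg _
  have hcb : √(a ^ 2 - b ^ 2) ^ 2 = a ^ 2 - b ^ 2 := Real.sq_sqrt (by linarith)
  have hca : √(a ^ 2 - b ^ 2) ≤ a := Real.sqrt_le_iff.2 ⟨ha.le, by nlinarith [sq_nonneg b]⟩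
  rw [Metric.mem_closedBall, EuclideanSpace.dist_eq, Fin.sum_univ_three,
    Real.sqrt_le_left hR0] at hB
  simp [Real.dist_eq] at hB
  generalize x 0 = x₀ at *
  generalize x 1 = x₁ at *
  generalize x 2 = x₂ at *
  generalize √(a ^ 2 - b ^ 2) = c at *
  obtain ⟨u, rfl⟩ : ∃ u, x₀ = a * u := ⟨x₀ / a, by field_simp⟩
  have hy : x₁ ^ 2 + x₂ ^ 2 = b ^ 2 * (1 - u ^ 2) := by
    field_simp at hS
    linarith
  have hu : -1 ≤ u := by
    have : 0 ≤ 1 - u ^ 2 := nonneg_of_mul_nonneg_right (hy ▸ by positivity) (pow_pos hb 2)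
    nlinarith
  have h1 : (a - c * u) ^ 2 ≤ R ^ 2 := by
    refine le_trans (le_of_eq ?_) hB
    linear_combination (u ^ 2 - 1) * hcb - hy
  have h2 : a - c * u ≤ R := abs_le_of_sq_le_sq' h1 hR0 |>.2
  rcases hR.lt_or_eq with h | h
  · have : 0 ≤ u := by
      by_contra! hneg
      nlinarith
    nlinarith
  · subst h
    nlinarith

/-- The longitude window `K` for a slab of normal `(n₀, N)`, together with the resulting bound on
the area of the height-longitude box. -/
lemma exists_longitude_bound {a b ρ δ h n₀ N : ℝ} (ha : 0 < a) (hb : 0 < b) (hρ : 0 < ρ)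
    (hbρ : b ≤ a * ρ) (hδ : 0 < δ) (hh : 0 < h) (hh2 : h ^ 2 = a ^ 2 * n₀ ^ 2 + b ^ 2 * N ^ 2)
    (hN : 0 ≤ N) (hn : n₀ ^ 2 + N ^ 2 = 1) :
    ∃ K, 0 ≤ K ∧ (∀ φ : ℝ, |φ| ≤ Real.pi →
      (b * N / h * φ) ^ 2 ≤ 2 * Real.pi ^ 2 * (2 * ρ ^ 2) → |φ| ≤ K) ∧
      a * b * (2 * ρ) * (δ / h * (2 * K)) ≤ 16 * Real.pi * (a * ρ ^ 2) * δ := by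
  have hpi := Real.pi_pos
  rcases le_total (1 / 2) (n₀ ^ 2) with hc | hc
  · refine ⟨Real.pi, hpi.le, fun φ hφ _ => hφ, ?_⟩
    have hah : a / 2 ≤ h := by
      refine abs_le_of_sq_le_sq' ?_ hh.le |>.2
      nlinarith [mul_le_mul_of_nonneg_left hc (sq_nonneg a), sq_nonneg (b * N)]
    have e : a * b * (2 * ρ) * (δ / h * (2 * Real.pi)) =
        (4 * Real.pi * a * ρ * δ) * b / h := by field_simp; ring
    rw [e, div_le_iff₀ hh]
    calc 4 * Real.pi * a * ρ * δ * b ≤ 4 * Real.pi * a * ρ * δ * (a * ρ) := by gcongr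
      _ = 8 * Real.pi * (a * ρ ^ 2) * δ * (a / 2) := by ring
      _ ≤ 16 * Real.pi * (a * ρ ^ 2) * δ * h := by gcongr; norm_num
  · have hN2 : 1 / 2 ≤ N := by
      refine abs_le_of_sq_le_sq' ?_ hN |>.2
      nlinarith
    have hN0 : 0 < N := by linarith
    have hd : 0 < b * N / h := by positivity
    refine ⟨2 * Real.pi * ρ / (b * N / h), by positivity, fun φ _ hφ => ?_, ?_⟩
    · rw [le_div_iff₀ hd, mul_comm, ← abs_of_pos hd, ← abs_mul]
      refine abs_le_of_sq_le_sq ?_ (by positivity)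
      refine hφ.trans_eq ?_
      ring
    · have e : a * b * (2 * ρ) * (δ / h * (2 * (2 * Real.pi * ρ / (b * N / h)))) =
          8 * Real.pi * (a * ρ ^ 2) * δ / N := by field_simp; ring
      rw [e, div_le_iff₀ hN0]
      calc 8 * Real.pi * (a * ρ ^ 2) * δ = 16 * Real.pi * (a * ρ ^ 2) * δ * (1 / 2) := by ring
        _ ≤ _ := by gcongr

/-- The part of an ellipsoid of revolution near a vertex and in a slab, in height-longitude
coordinates adapted to the slab. -/
lemma exists_sphereCoord_of_mem_ellipsoid {a b c d h n₀ N w₁ w₂ t δ ρ K x₀ x₁ x₂ : ℝ}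
    (ha : 0 < a) (hb : 0 < b) (hh : 0 < h) (hρ : 0 < ρ) (hd : 0 ≤ d) (hcd : c ^ 2 + d ^ 2 = 1)
    (hw : w₁ ^ 2 + w₂ ^ 2 = 1) (hc : a * n₀ = h * c) (hN : b * N = h * d)
    (hS : x₀ ^ 2 / a ^ 2 + (x₁ ^ 2 + x₂ ^ 2) / b ^ 2 = 1) (hcap : a - 2 * (a * ρ ^ 2) ≤ x₀)
    (ht₁ : t ≤ n₀ * x₀ + N * w₁ * x₁ + N * w₂ * x₂)
    (ht₂ : n₀ * x₀ + N * w₁ * x₁ + N * w₂ * x₂ ≤ t + δ)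
    (hK : ∀ φ : ℝ, |φ| ≤ Real.pi →
      (d * φ) ^ 2 ≤ 2 * Real.pi ^ 2 * (2 * ρ ^ 2) → |φ| ≤ K) :
    ∃ z ∈ Icc (t / h) (t / h + δ / h) ×ˢ Icc (-K) K, 0 ≤ 1 - z.1 ^ 2 ∧
      |sphereCoord c d 0 z| ≤ 1 ∧ |sphereCoord (d * w₁) (-c * w₁) (-w₂) z| ≤ 2 * ρ ∧
      |sphereCoord (d * w₂) (-c * w₂) w₁ z| ≤ 2 * ρ ∧
      x₀ = a * sphereCoord c d 0 z ∧ x₁ = b * sphereCoord (d * w₁) (-c * w₁) (-w₂) z ∧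
      x₂ = b * sphereCoord (d * w₂) (-c * w₂) w₁ z := by
  obtain ⟨u₀, rfl⟩ : ∃ u, x₀ = a * u := ⟨x₀ / a, by field_simp⟩
  obtain ⟨u₁, rfl⟩ : ∃ u, x₁ = b * u := ⟨x₁ / b, by field_simp⟩
  obtain ⟨u₂, rfl⟩ : ∃ u, x₂ = b * u := ⟨x₂ / b, by field_simp⟩
  have hu : u₀ ^ 2 + u₁ ^ 2 + u₂ ^ 2 = 1 := by
    field_simp at hS
    linarith
  have habs₀ : |u₀| ≤ 1 := abs_le_one_iff_mul_self_le_one.2 (by nlinarith)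
  have hcap' : 1 - 2 * ρ ^ 2 ≤ u₀ := le_of_mul_le_mul_left (by linarith) ha
  have habs : u₁ ^ 2 + u₂ ^ 2 ≤ (2 * ρ) ^ 2 := by
    nlinarith [(abs_le.1 habs₀).1, (abs_le.1 habs₀).2]
  obtain ⟨φ, hφ, e₀, e₁, e₂⟩ := exists_sphereCoord hcd hw hu
  have hinner : n₀ * (a * u₀) + N * w₁ * (b * u₁) + N * w₂ * (b * u₂) =
      h * (c * u₀ + d * w₁ * u₁ + d * w₂ * u₂) := by
    linear_combination u₀ * hc + (w₁ * u₁ + w₂ * u₂) * hN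
  rw [hinner] at ht₁ ht₂
  have hs1 : 0 ≤ 1 - (c * u₀ + d * w₁ * u₁ + d * w₂ * u₂) ^ 2 := by
    have : 1 - (c * u₀ + d * w₁ * u₁ + d * w₂ * u₂) ^ 2 =
        (d * u₀ - c * w₁ * u₁ - c * w₂ * u₂) ^ 2 + (-w₂ * u₁ + w₁ * u₂) ^ 2 := by
      linear_combination -hu - (u₀ ^ 2 + (w₁ * u₁ + w₂ * u₂) ^ 2) * hcd
        - (u₁ ^ 2 + u₂ ^ 2) * hw
    rw [this]; positivity
  have hφK : |φ| ≤ K := hK φ hφ (sq_longitude_le hcd hd hs1 hφ (by rwa [e₀]))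
  refine ⟨(_, φ), ⟨⟨?_, ?_⟩, abs_le.1 hφK⟩, hs1, ?_, ?_, ?_, ?_, ?_, ?_⟩
  · rw [div_le_iff₀ hh]; linarith
  · rw [← add_div, le_div_iff₀ hh]; linarith
  · rwa [e₀]
  · rw [e₁]
    exact abs_le_of_sq_le_sq (by nlinarith [sq_nonneg u₂]) (by positivity)
  · rw [e₂]
    exact abs_le_of_sq_le_sq (by nlinarith [sq_nonneg u₁]) (by positivity)
  · rw [e₀]
  · rw [e₁]
  · rw [e₂]

/-- Area of intersection of an ellipsoid of revolution with a ball centered at a focus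
and a thickened plane. -/
theorem ellipsoid_ball_plane_area :
    ∃ C > (0 : ℝ), ∀ (a b : ℝ), 0 < b → b ≤ a →
      ∀ (R : ℝ), b ^ 2 / a ≤ R → R ≤ a →
      ∀ (δ : ℝ), 0 < δ →
      ∀ (n : E3), ‖n‖ = 1 → ∀ (t : ℝ),
      μH[2] ({x : E3 | (x 0) ^ 2 / a ^ 2 + ((x 1) ^ 2 + (x 2) ^ 2) / b ^ 2 = 1}
          ∩ Metric.closedBall
              ((WithLp.equiv 2 ((i : Fin 3) → ℝ)).symm ![Real.sqrt (a ^ 2 - b ^ 2), 0, 0]) R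
          ∩ {x : E3 | t ≤ ⟪x, n⟫_ℝ ∧ ⟪x, n⟫_ℝ ≤ t + δ})
        ≤ ENNReal.ofReal (C * R * δ) := by
  have hpi := Real.pi_pos
  refine ⟨54 * (16 * Real.pi), by positivity, ?_⟩
  intro a b hb hba R hR hRa δ hδ n hn t
  have ha : 0 < a := hb.trans_le hba
  have hR0 : 0 < R := lt_of_lt_of_le (by positivity) hR
  obtain ⟨ρ, hρ, hρR⟩ : ∃ ρ : ℝ, 0 < ρ ∧ R = a * ρ ^ 2 := by
    refine ⟨√(R / a), by positivity, ?_⟩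
    rw [Real.sq_sqrt (by positivity)]
    field_simp
  have hbρ : b ≤ a * ρ := by
    refine abs_le_of_sq_le_sq' ?_ (by positivity) |>.2
    rw [div_le_iff₀ ha, hρR] at hR
    linarith
  obtain ⟨N, w₁, w₂, hN, hw, hn₁, hn₂⟩ : ∃ N w₁ w₂ : ℝ, 0 ≤ N ∧ w₁ ^ 2 + w₂ ^ 2 = 1 ∧
      n 1 = N * w₁ ∧ n 2 = N * w₂ :=
    ⟨‖(⟨n 1, n 2⟩ : ℂ)‖, Real.cos (Complex.arg ⟨n 1, n 2⟩), Real.sin (Complex.arg ⟨n 1, n 2⟩),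
      norm_nonneg _, Real.cos_sq_add_sin_sq _, (Complex.norm_mul_cos_arg ⟨n 1, n 2⟩).symm,
      (Complex.norm_mul_sin_arg ⟨n 1, n 2⟩).symm⟩
  have hnN : n 0 ^ 2 + N ^ 2 = 1 := by
    have h := EuclideanSpace.real_norm_sq_eq n
    rw [hn, Fin.sum_univ_three, hn₁, hn₂] at h
    linear_combination -h - N ^ 2 * hw
  have hpos : 0 < a ^ 2 * n 0 ^ 2 + b ^ 2 * N ^ 2 := by
    have hab : b ^ 2 ≤ a ^ 2 := pow_le_pow_left₀ hb.le hba 2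
    nlinarith [mul_le_mul_of_nonneg_right hab (sq_nonneg (n 0)), sq_pos_of_pos hb]
  obtain ⟨h, hh, hh2⟩ : ∃ h : ℝ, 0 < h ∧ h ^ 2 = a ^ 2 * n 0 ^ 2 + b ^ 2 * N ^ 2 :=
    ⟨_, Real.sqrt_pos.2 hpos, Real.sq_sqrt hpos.le⟩
  obtain ⟨K, hK0, hK, hV⟩ := exists_longitude_bound ha hb hρ hbρ hδ hh hh2 hN hnN
  set c := a * n 0 / h with hc
  set d := b * N / h with hd
  have hd0 : 0 ≤ d := by positivity
  have hcd : c ^ 2 + d ^ 2 = 1 := by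
    rw [hc, hd, div_pow, div_pow, ← add_div, div_eq_one_iff_eq (by positivity), hh2]
    ring
  set X := {x : E3 | (x 0) ^ 2 / a ^ 2 + ((x 1) ^ 2 + (x 2) ^ 2) / b ^ 2 = 1}
          ∩ Metric.closedBall
              ((WithLp.equiv 2 ((i : Fin 3) → ℝ)).symm ![Real.sqrt (a ^ 2 - b ^ 2), 0, 0]) R
          ∩ {x : E3 | t ≤ ⟪x, n⟫_ℝ ∧ ⟪x, n⟫_ℝ ≤ t + δ}
  have hinner : ∀ x : E3, ⟪x, n⟫_ℝ = n 0 * x 0 + n 1 * x 1 + n 2 * x 2 := fun x => by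
    simp [PiLp.inner_apply, Fin.sum_univ_three]
  have hparam : ∀ x ∈ X, ∃ z ∈ Icc (t / h) (t / h + δ / h) ×ˢ Icc (-K) K, 0 ≤ 1 - z.1 ^ 2 ∧
      |sphereCoord c d 0 z| ≤ 1 ∧ |sphereCoord (d * w₁) (-c * w₁) (-w₂) z| ≤ 2 * ρ ∧
      |sphereCoord (d * w₂) (-c * w₂) w₁ z| ≤ 2 * ρ ∧
      x 0 = a * sphereCoord c d 0 z ∧ x 1 = b * sphereCoord (d * w₁) (-c * w₁) (-w₂) z ∧
      x 2 = b * sphereCoord (d * w₂) (-c * w₂) w₁ z := by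
    rintro x ⟨⟨hS, hB⟩, hP⟩
    rw [mem_ofPred_eq] at hS
    refine exists_sphereCoord_of_mem_ellipsoid (n₀ := n 0) (N := N) ha hb hh hρ hd0 hcd hw
      (by rw [hc]; field_simp) (by rw [hd]; field_simp) hS ?_ ?_ ?_ hK
    · rw [← hρR]
      exact cap_of_mem_closedBall_focus hb hba hR0.le hRa hS hB
    · rw [← hn₁, ← hn₂, ← hinner]
      exact hP.1
    · rw [← hn₁, ← hn₂, ← hinner]
      exact hP.2
  have hwδ : 0 ≤ δ / h := by positivity
  have hb2 : b * b * 1 * (δ / h * (2 * K)) ≤ a * b * (2 * ρ) * (δ / h * (2 * K)) := by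
    refine mul_le_mul_of_nonneg_right ?_ (by positivity)
    nlinarith [mul_pos ha hρ]
  have hmain : μH[2] X ≤ 54 * ENNReal.ofReal (16 * Real.pi * (a * ρ ^ 2) * δ) := by
    refine hausdorffMeasure_le_coordPair (k := ![1 / a ^ 2, 1 / b ^ 2, 1 / b ^ 2]) ?_ ?_ ?_ ?_ ?_
    · intro i
      fin_cases i <;> simp <;> positivity
    · intro x hx
      refine Eq.trans ?_ hx.1.1
      rw [Fin.sum_univ_three]
      simp
      ring
    · refine (volume_coordPair_image_le (t := t / h) (w := δ / h) (K := K) (ε := -1) (L := 1)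
        (m₀ := d * w₁) (p₀ := -c * w₁) (q₀ := -w₂)
        (m₁ := d * w₂) (p₁ := -c * w₂) (q₁ := w₁)
        (m₂ := c) (p₂ := d) (q₂ := 0)
        hb.le hb.le (by positivity) hwδ (by simp)
        (by linear_combination -c * hw) (by ring) (by linear_combination d * hw)
        fun x hx => ?_).trans (ENNReal.ofReal_le_ofReal (le_trans hb2 hV))
      obtain ⟨z, hz, h1, h2, -, -, -, h3, h4⟩ := hparam x hx
      exact ⟨z, hz, h1, h2, h3, h4⟩
    · refine (volume_coordPair_image_le (t := t / h) (w := δ / h) (K := K) (ε := 1) (L := 2 * ρ)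
        (m₀ := c) (p₀ := d) (q₀ := 0)
        (m₁ := d * w₂) (p₁ := -c * w₂) (q₁ := w₁)
        (m₂ := d * w₁) (p₂ := -c * w₁) (q₂ := -w₂)
        ha.le hb.le (by positivity) hwδ (by simp)
        (by ring) (by linear_combination -w₂ * hcd) (by ring)
        fun x hx => ?_).trans (ENNReal.ofReal_le_ofReal hV)
      obtain ⟨z, hz, h1, -, h2, -, h3, -, h4⟩ := hparam x hx
      exact ⟨z, hz, h1, h2, h3, h4⟩
    · refine (volume_coordPair_image_le (t := t / h) (w := δ / h) (K := K) (ε := -1) (L := 2 * ρ)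
        (m₀ := c) (p₀ := d) (q₀ := 0)
        (m₁ := d * w₁) (p₁ := -c * w₁) (q₁ := -w₂)
        (m₂ := d * w₂) (p₂ := -c * w₂) (q₂ := w₁)
        ha.le hb.le (by positivity) hwδ (by simp)
        (by ring) (by linear_combination -w₁ * hcd) (by ring)
        fun x hx => ?_).trans (ENNReal.ofReal_le_ofReal hV)
      obtain ⟨z, hz, h1, -, -, h2, h3, h4, -⟩ := hparam x hx
      exact ⟨z, hz, h1, h2, h3, h4⟩
  refine hmain.trans_eq ?_
  rw [hρR, ← ENNReal.ofReal_ofNat 54, ← ENNReal.ofReal_mul (by norm_num)]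
  ring_nf
end
end

section
/- There is a universal constant C > 0 with the following property. Let a ≥ b > 0, let S = {(x, y, z) ∈ ℝ³ : x²/a² − (y² + z²)/b² = 1} be the hyperboloid of revolution obtained by revolving x²/a² − y²/b² = 1 about the x-axis, and let B ⊂ ℝ³ be a closed ball of radius R centered at the focus (√(a² + b²), 0, 0), where b²/a ≤ R ≤ a. Let δ > 0 and let P = {x ∈ ℝ³ : t ≤ x·n ≤ t + δ} be any δ-thickened plane (n ∈ ℝ³ a unit vector, t ∈ ℝ). Then μH²(S ∩ B ∩ P) ≤ C·R·δ, where μH² denotes the 2-dimensional Hausdorff measure on ℝ³. -/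
open MeasureTheory Set
open scoped ENNReal InnerProductSpace

noncomputable section

theorem hausdorffMeasure_le_of_dist_le {X Y : Type*} [MetricSpace X] [MeasurableSpace X]
    [BorelSpace X] [MetricSpace Y] [MeasurableSpace Y] [BorelSpace Y] {f : X → Y} {s : Set X}
    {t : Set Y} {K : NNReal} {d : ℝ} (hd : 0 ≤ d)
    (h : ∀ p ∈ s, ∀ q ∈ s, dist p q ≤ K * dist (f p) (f q)) (hst : MapsTo f s t) :
    μH[d] s ≤ (K : ℝ≥0∞) ^ d * μH[d] t := by
  rcases s.eq_empty_or_nonempty with rfl | ⟨x, hx⟩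
  · simp
  have : Nonempty X := ⟨x⟩
  have hinj : InjOn f s := by
    intro p hp q hq hpq
    have := h p hp q hq
    rw [hpq, dist_self, mul_zero] at this
    exact dist_le_zero.1 this
  have hlip : LipschitzOnWith K (Function.invFunOn f s) (f '' s) := by
    refine LipschitzOnWith.of_dist_le_mul ?_
    rintro _ ⟨p, hp, rfl⟩ _ ⟨q, hq, rfl⟩
    rw [hinj.leftInvOn_invFunOn hp, hinj.leftInvOn_invFunOn hq]
    exact h p hp q hq
  calc μH[d] s = μH[d] (Function.invFunOn f s '' (f '' s)) := by
        rw [hinj.invFunOn_image Subset.rfl]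
    _ ≤ (K : ℝ≥0∞) ^ d * μH[d] (f '' s) := hlip.hausdorffMeasure_image_le hd
    _ ≤ _ := by gcongr; exact hst.image_subset

/-- The radial part of the area of a planar set whose rays from the origin meet it in a set
on which `r ^ 2` varies by at most `m`. -/
theorem setLIntegral_ofReal_le_of_sq_sub_sq_le {E : Set ℝ} {m : ℝ} (hE : E ⊆ Ioi 0)
    (h : ∀ r ∈ E, ∀ s ∈ E, r ^ 2 - s ^ 2 ≤ m) :
    ∫⁻ r in E, ENNReal.ofReal r ≤ ENNReal.ofReal (m / 2) := by
  rcases E.eq_empty_or_nonempty with rfl | ⟨r₁, hr₁⟩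
  · simp
  have hm : 0 ≤ m := by simpa using h r₁ hr₁ r₁ hr₁
  have hbdd : BddBelow E := ⟨0, fun r hr => (hE hr).le⟩
  set r₀ := sInf E with hr₀
  have h0 : 0 ≤ r₀ := le_csInf ⟨r₁, hr₁⟩ fun r hr => (hE hr).le
  have hsub : E ⊆ Icc r₀ √(r₀ ^ 2 + m) := by
    intro r hr
    refine ⟨csInf_le hbdd hr, Real.le_sqrt_of_sq_le ?_⟩
    have hrpos : 0 < r := hE hr
    have key : √(r ^ 2 - m) ≤ r₀ := by
      refine le_csInf ⟨r₁, hr₁⟩ fun s hs => ?_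
      exact Real.sqrt_le_iff.2 ⟨(hE hs).le, by linarith [h r hr s hs]⟩
    have := (Real.sqrt_le_left h0).1 key
    linarith
  have hle : r₀ ≤ √(r₀ ^ 2 + m) := Real.le_sqrt_of_sq_le (by linarith)
  calc ∫⁻ r in E, ENNReal.ofReal r ≤ ∫⁻ r in Icc r₀ √(r₀ ^ 2 + m), ENNReal.ofReal r :=
        lintegral_mono_set hsub
    _ = ENNReal.ofReal (∫ r in Icc r₀ √(r₀ ^ 2 + m), r) := by
        rw [ofReal_integral_eq_lintegral_ofReal]
        · exact (continuous_id.integrableOn_Icc)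
        · filter_upwards [ae_restrict_mem measurableSet_Icc] with r hr
          exact h0.trans hr.1
    _ = _ := by
        rw [integral_Icc_eq_integral_Ioc, ← intervalIntegral.integral_of_le hle, integral_id,
          Real.sq_sqrt (by positivity)]
        congr 1
        ring

theorem volume_le_of_sq_sub_sq_le_on_rays {T : Set (ℝ × ℝ)} (hT : MeasurableSet T) (p : ℝ × ℝ)
    {m : ℝ} (hm : 0 ≤ m)
    (h : ∀ c d : ℝ, c ^ 2 + d ^ 2 = 1 → ∀ r > 0, ∀ s > 0, (p.1 + r * c, p.2 + r * d) ∈ T →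
      (p.1 + s * c, p.2 + s * d) ∈ T → r ^ 2 - s ^ 2 ≤ m) :
    volume T ≤ ENNReal.ofReal (Real.pi * m) := by
  set T' : Set (ℝ × ℝ) := (fun q => p + q) ⁻¹' T with hT'
  have hT'm : MeasurableSet T' := hT.preimage (by fun_prop)
  have hvol : volume T = volume T' := (measure_preimage_add volume p T).symm
  rw [hvol, ← lintegral_indicator_one hT'm, ← lintegral_comp_polarCoord_symm]
  have hmeas : Measurable fun q : ℝ × ℝ =>
      ENNReal.ofReal q.1 • T'.indicator (1 : ℝ × ℝ → ℝ≥0∞) (polarCoord.symm q) := by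
    refine Measurable.mul (by fun_prop) ?_
    exact (measurable_one.indicator hT'm).comp continuous_polarCoord_symm.measurable
  have htar : polarCoord.target = Ioi (0 : ℝ) ×ˢ Ioo (-Real.pi) Real.pi := rfl
  rw [htar, Measure.volume_eq_prod, setLIntegral_prod_symm _ hmeas.aemeasurable]
  calc _ ≤ ∫⁻ _ in Ioo (-Real.pi) Real.pi, ENNReal.ofReal (m / 2) := by
        refine lintegral_mono fun θ => ?_
        set E : Set ℝ := Ioi 0 ∩ {r | polarCoord.symm (r, θ) ∈ T'} with hE
        have hmE : MeasurableSet {r : ℝ | polarCoord.symm (r, θ) ∈ T'} :=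
          hT'm.preimage (continuous_polarCoord_symm.measurable.comp (by fun_prop))
        have hEle := setLIntegral_ofReal_le_of_sq_sub_sq_le (E := E) (m := m)
          inter_subset_left (by
            rintro r ⟨hr, hrT⟩ s ⟨hs, hsT⟩
            exact h (Real.cos θ) (Real.sin θ) (Real.cos_sq_add_sin_sq θ) r hr s hs hrT hsT)
        refine le_trans (le_of_eq ?_) hEle
        rw [hE, inter_comm, ← setLIntegral_indicator hmE]
        refine lintegral_congr fun r => ?_
        by_cases hr : polarCoord.symm (r, θ) ∈ T'
        · simp only [indicator, hr, mem_ofPred_eq]; simp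
        · simp only [indicator, hr, mem_ofPred_eq]; simp
    _ = ENNReal.ofReal (Real.pi * m) := by
        rw [setLIntegral_const, Real.volume_Ioo, ← ENNReal.ofReal_mul (by positivity)]
        congr 1
        ring

theorem volume_le_of_slices {T : Set (ℝ × ℝ)} (hT : MeasurableSet T) {ρ d : ℝ} (hd : 0 ≤ d)
    (hρ : ∀ p ∈ T, |p.2| ≤ ρ)
    (h : ∀ u u' v : ℝ, (u, v) ∈ T → (u', v) ∈ T → |u - u'| ≤ d) :
    volume T ≤ ENNReal.ofReal (2 * ρ * d) := by
  rw [Measure.volume_eq_prod, Measure.prod_apply_symm hT]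
  calc _ ≤ ∫⁻ v, (Icc (-ρ) ρ).indicator (fun _ => ENNReal.ofReal d) v := by
        refine lintegral_mono fun v => ?_
        by_cases hv : v ∈ Icc (-ρ) ρ
        · rw [indicator_of_mem hv]
          refine (Real.volume_le_diam _).trans (Metric.ediam_le fun u hu u' hu' => ?_)
          rw [edist_dist]
          exact ENNReal.ofReal_le_ofReal (h u u' v hu hu')
        · have : (fun x : ℝ => (x, v)) ⁻¹' T = ∅ := by
            ext u
            simp only [mem_preimage, mem_empty_iff_false, iff_false]
            exact fun hu => hv (abs_le.1 (hρ _ hu))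
          simp [this]
    _ = _ := by
        rw [lintegral_indicator_const measurableSet_Icc, Real.volume_Icc,
          ← ENNReal.ofReal_mul hd]
        congr 1
        ring

theorem volume_image_shear_le {T : Set (ℝ × ℝ)} (hT : IsCompact T) {X : ℝ → ℝ → ℝ}
    (hX : Continuous fun p : ℝ × ℝ => X p.1 p.2) {M : NNReal}
    (h : ∀ u u' v : ℝ, (u, v) ∈ T → (u', v) ∈ T → |X u v - X u' v| ≤ M * |u - u'|) :
    volume ((fun p : ℝ × ℝ => (X p.1 p.2, p.2)) '' T) ≤ M * volume T := by
  have hc : Continuous fun p : ℝ × ℝ => (X p.1 p.2, p.2) := by fun_prop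
  have hTm := hT.measurableSet
  rw [Measure.volume_eq_prod, Measure.prod_apply_symm (hT.image hc).measurableSet,
    Measure.prod_apply_symm hTm, ← lintegral_const_mul _ (measurable_measure_prodMk_right hTm)]
  refine lintegral_mono fun v => ?_
  have himg : (fun x : ℝ => (x, v)) ⁻¹' ((fun p : ℝ × ℝ => (X p.1 p.2, p.2)) '' T)
      = (fun u => X u v) '' ((fun x : ℝ => (x, v)) ⁻¹' T) := by
    ext x
    simp only [mem_preimage, mem_image, Prod.exists, Prod.mk.injEq]
    constructor
    · rintro ⟨u, _, hu, rfl, rfl⟩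
      exact ⟨u, hu, rfl⟩
    · rintro ⟨u, hu, rfl⟩
      exact ⟨u, v, hu, rfl, rfl⟩
  have hlip : LipschitzOnWith M (fun u => X u v) ((fun x : ℝ => (x, v)) ⁻¹' T) :=
    LipschitzOnWith.of_dist_le_mul fun u hu u' hu' => h u u' v hu hu'
  have := hlip.hausdorffMeasure_image_le (d := 1) zero_le_one
  rw [hausdorffMeasure_real, ENNReal.rpow_one] at this
  simpa only [himg] using this

/-- The height `x` of the right sheet of the hyperboloid above the point `(u, v)`. -/
def sheet (a b u v : ℝ) : ℝ := a * √(1 + (u ^ 2 + v ^ 2) / b ^ 2)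

/-- The points of the disc of radius `ρ` above which the right sheet of the hyperboloid lies
in the slab `t ≤ α x + β u + γ v ≤ t + δ`. -/
def slabRegion (a b ρ α β γ t δ : ℝ) : Set (ℝ × ℝ) :=
  {p | p.1 ^ 2 + p.2 ^ 2 ≤ ρ ^ 2} ∩
    {p | t ≤ α * sheet a b p.1 p.2 + β * p.1 + γ * p.2 ∧
      α * sheet a b p.1 p.2 + β * p.1 + γ * p.2 ≤ t + δ}

theorem continuous_sheet (a b : ℝ) : Continuous fun p : ℝ × ℝ => sheet a b p.1 p.2 := by
  unfold sheet
  fun_prop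

theorem sheet_sq {a b : ℝ} (hb : 0 < b) (u v : ℝ) :
    b ^ 2 * sheet a b u v ^ 2 = a ^ 2 * (b ^ 2 + (u ^ 2 + v ^ 2)) := by
  unfold sheet
  rw [mul_pow, Real.sq_sqrt (by positivity)]
  field_simp

theorem le_sheet {a : ℝ} (b : ℝ) (ha : 0 < a) (u v : ℝ) : a ≤ sheet a b u v := by
  unfold sheet
  refine le_mul_of_one_le_right ha.le (Real.one_le_sqrt.2 ?_)
  have : 0 ≤ (u ^ 2 + v ^ 2) / b ^ 2 := by positivity
  linarith

theorem sheet_comm (a b u v : ℝ) : sheet a b u v = sheet a b v u := by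
  unfold sheet
  rw [add_comm (u ^ 2)]

theorem sheet_le {a b : ℝ} (ha : 0 < a) (hb : 0 < b) {u v : ℝ}
    (h : u ^ 2 + v ^ 2 ≤ 8 * b ^ 2) : sheet a b u v ≤ 3 * a := by
  have h1 := sheet_sq (a := a) hb u v
  have h2 : b ^ 2 * sheet a b u v ^ 2 ≤ b ^ 2 * (3 * a) ^ 2 := by
    rw [h1]
    nlinarith [mul_le_mul_of_nonneg_left h (sq_nonneg a)]
  exact (pow_le_pow_iff_left₀ (ha.le.trans (le_sheet b ha u v)) (by positivity) two_ne_zero).1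
    (le_of_mul_le_mul_left h2 (by positivity))

theorem abs_sheet_sub_le {a b ρ : ℝ} (ha : 0 < a) (hb : 0 < b) {u u' v : ℝ} (hu : |u| ≤ ρ)
    (hu' : |u'| ≤ ρ) : |sheet a b u v - sheet a b u' v| ≤ a * ρ / b ^ 2 * |u - u'| := by
  have h1 := sheet_sq (a := a) hb u v
  have h2 := sheet_sq (a := a) hb u' v
  have l1 := le_sheet b ha u v
  have l2 := le_sheet b ha u' v
  set X := sheet a b u v
  set X' := sheet a b u' v
  have key : b ^ 2 * (X + X') * |X - X'| = a ^ 2 * (|u + u'| * |u - u'|) := by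
    have e1 : b ^ 2 * (X + X') * |X - X'| = |b ^ 2 * (X + X') * (X - X')| := by
      rw [abs_mul, abs_of_pos (mul_pos (by positivity) (by linarith) : 0 < b ^ 2 * (X + X'))]
    have e2 : a ^ 2 * (|u + u'| * |u - u'|) = |a ^ 2 * ((u + u') * (u - u'))| := by
      rw [abs_mul, abs_mul, abs_of_pos (by positivity : 0 < a ^ 2)]
    rw [e1, e2]
    congr 1
    linear_combination h1 - h2
  have hs : |u + u'| ≤ 2 * ρ := (abs_add_le _ _).trans (by linarith)
  have h3 : b ^ 2 * (2 * a) * |X - X'| ≤ a ^ 2 * (2 * ρ * |u - u'|) := by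
    calc _ ≤ b ^ 2 * (X + X') * |X - X'| := by gcongr; linarith
      _ = _ := key
      _ ≤ _ := by gcongr
  rw [div_mul_eq_mul_div, le_div_iff₀ (by positivity)]
  have h4 : a * (|X - X'| * b ^ 2) ≤ a * (a * ρ * |u - u'|) := by nlinarith
  exact le_of_mul_le_mul_left h4 ha

/-- Strong convexity of the sheet, in tangent form. -/
theorem sheet_tangent_le {a b : ℝ} (ha : 0 < a) (hb : 0 < b) {u v u' v' : ℝ}
    (h : u ^ 2 + v ^ 2 ≤ 8 * b ^ 2) (h' : u' ^ 2 + v' ^ 2 ≤ 8 * b ^ 2) :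
    sheet a b u v + a ^ 2 / (b ^ 2 * sheet a b u v) * (u * (u' - u) + v * (v' - v))
      + a / (54 * b ^ 2) * ((u' - u) ^ 2 + (v' - v) ^ 2) ≤ sheet a b u' v' := by
  have h1 := sheet_sq (a := a) hb u v
  have h2 := sheet_sq (a := a) hb u' v'
  have l1 := le_sheet b ha u v
  have l2 := le_sheet b ha u' v'
  have m1 := sheet_le ha hb h
  have m2 := sheet_le ha hb h'
  set X := sheet a b u v
  set Y := sheet a b u' v'
  have hX : 0 < X := ha.trans_le l1
  have hY : 0 < Y := ha.trans_le l2
  set A := b ^ 2 * (X * Y) with hA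
  set B := a ^ 2 * (b ^ 2 + (u * u' + v * v')) with hB
  set N := (u' - u) ^ 2 + (v' - v) ^ 2 with hN
  have hApos : 0 < A := by positivity
  have hdiff : A ^ 2 - B ^ 2 = a ^ 4 * (b ^ 2 * N + (u * v' - v * u') ^ 2) := by
    have : A ^ 2 = (a ^ 2 * (b ^ 2 + (u ^ 2 + v ^ 2))) * (a ^ 2 * (b ^ 2 + (u' ^ 2 + v' ^ 2))) := by
      rw [← h1, ← h2, hA]; ring
    rw [this, hB, hN]; ring
  have hdiff' : a ^ 4 * (b ^ 2 * N) ≤ A ^ 2 - B ^ 2 := by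
    rw [hdiff]; gcongr; nlinarith [sq_nonneg (u * v' - v * u')]
  have hNnn : 0 ≤ N := by positivity
  have hBA : B ≤ A := by
    refine le_of_sq_le_sq ?_ hApos.le
    have : 0 ≤ a ^ 4 * (b ^ 2 * N) := by positivity
    linarith
  have hA9 : A ≤ 9 * a ^ 2 * b ^ 2 := by
    have : X * Y ≤ 3 * a * (3 * a) := by gcongr
    rw [hA]; nlinarith [sq_nonneg b, mul_le_mul_of_nonneg_left this (sq_nonneg b)]
  have hAB : a ^ 2 * N ≤ 18 * (A - B) := by
    have h5 : A ^ 2 - B ^ 2 ≤ (A - B) * (18 * a ^ 2 * b ^ 2) := by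
      have : A ^ 2 - B ^ 2 = (A - B) * (A + B) := by ring
      rw [this]
      exact mul_le_mul_of_nonneg_left (by linarith) (by linarith)
    have h6 : (a ^ 2 * b ^ 2) * (a ^ 2 * N) ≤ (a ^ 2 * b ^ 2) * (18 * (A - B)) := by
      linarith
    exact le_of_mul_le_mul_left h6 (by positivity)
  have hfin : a / (54 * b ^ 2) * N ≤ (A - B) / (b ^ 2 * X) := by
    rw [div_mul_eq_mul_div, div_le_div_iff₀ (by positivity) (by positivity)]
    have : a * N * (b ^ 2 * X) ≤ a * N * (b ^ 2 * (3 * a)) := by gcongr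
    nlinarith [mul_le_mul_of_nonneg_left hAB (sq_nonneg b)]
  have hsplit : (A - B) / (b ^ 2 * X)
      = Y - X - a ^ 2 / (b ^ 2 * X) * (u * (u' - u) + v * (v' - v)) := by
    field_simp
    rw [hA, hB]
    linear_combination h1
  linarith

theorem sq_add_sq_segment_le {u v u' v' s m : ℝ} (h : u ^ 2 + v ^ 2 ≤ m)
    (h' : u' ^ 2 + v' ^ 2 ≤ m) (hs : 0 ≤ s) (hs' : s ≤ 1) :
    ((1 - s) * u + s * u') ^ 2 + ((1 - s) * v + s * v') ^ 2 ≤ m := by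
  have e : ((1 - s) * u + s * u') ^ 2 + ((1 - s) * v + s * v') ^ 2
      = (1 - s) * (u ^ 2 + v ^ 2) + s * (u' ^ 2 + v' ^ 2)
        - s * (1 - s) * ((u' - u) ^ 2 + (v' - v) ^ 2) := by ring
  have : 0 ≤ s * (1 - s) * ((u' - u) ^ 2 + (v' - v) ^ 2) :=
    mul_nonneg (mul_nonneg hs (by linarith)) (by positivity)
  nlinarith

theorem sheet_strongConvex {a b : ℝ} (ha : 0 < a) (hb : 0 < b) {u v u' v' s : ℝ}
    (h : u ^ 2 + v ^ 2 ≤ 8 * b ^ 2) (h' : u' ^ 2 + v' ^ 2 ≤ 8 * b ^ 2) (hs : 0 ≤ s)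
    (hs' : s ≤ 1) :
    sheet a b ((1 - s) * u + s * u') ((1 - s) * v + s * v') ≤
      (1 - s) * sheet a b u v + s * sheet a b u' v'
        - a / (54 * b ^ 2) * (s * (1 - s)) * ((u' - u) ^ 2 + (v' - v) ^ 2) := by
  have hm : ((1 - s) * u + s * u') ^ 2 + ((1 - s) * v + s * v') ^ 2 ≤ 8 * b ^ 2 :=
    sq_add_sq_segment_le h h' hs hs'
  have e1 := mul_le_mul_of_nonneg_left (sheet_tangent_le ha hb hm h) (by linarith : 0 ≤ 1 - s)
  have e2 := mul_le_mul_of_nonneg_left (sheet_tangent_le ha hb hm h') hs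
  linear_combination e1 + e2

theorem volume_slab_le_of_strongConvex {D : Set (ℝ × ℝ)} (hD : IsCompact D) {f : ℝ × ℝ → ℝ}
    (hf : Continuous f) {μ t δ : ℝ} (hμ : 0 < μ) (hδ : 0 ≤ δ)
    (hD' : ∀ p ∈ D, ∀ q ∈ D, ∀ s : ℝ, 0 ≤ s → s ≤ 1 → (1 - s) • p + s • q ∈ D)
    (h : ∀ p ∈ D, ∀ q ∈ D, ∀ s : ℝ, 0 ≤ s → s ≤ 1 → f ((1 - s) • p + s • q) ≤
      (1 - s) * f p + s * f q - μ * (s * (1 - s)) * ((q.1 - p.1) ^ 2 + (q.2 - p.2) ^ 2)) :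
    volume (D ∩ {p | t ≤ f p ∧ f p ≤ t + δ}) ≤ ENNReal.ofReal (Real.pi * (2 * δ / μ)) := by
  rcases D.eq_empty_or_nonempty with rfl | hne
  · simp
  obtain ⟨p, hp, hmin⟩ := hD.exists_isMinOn hne hf.continuousOn
  have hmeas : MeasurableSet (D ∩ {p | t ≤ f p ∧ f p ≤ t + δ}) :=
    (hD.isClosed.inter ((isClosed_le continuous_const hf).inter
      (isClosed_le hf continuous_const))).measurableSet
  refine volume_le_of_sq_sub_sq_le_on_rays hmeas p (by positivity) ?_
  rintro c d hcd r hr s hs ⟨hrD, hr1, hr2⟩ ⟨hsD, hs1, hs2⟩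
  rcases le_total r s with hrs | hsr
  · have : r ^ 2 ≤ s ^ 2 := by gcongr
    have : 0 ≤ 2 * δ / μ := by positivity
    linarith
  set q : ℝ × ℝ := (p.1 + r * c, p.2 + r * d) with hq
  set w : ℝ × ℝ := (p.1 + s * c, p.2 + s * d) with hw
  have hσ0 : 0 ≤ s / r := by positivity
  have hσ1 : s / r ≤ 1 := (div_le_one hr).2 hsr
  have hwq : (1 - s / r) • p + (s / r) • q = w := by
    ext
    · simp only [hq, hw, Prod.fst_add, Prod.smul_fst, smul_eq_mul]
      field_simp
      ring
    · simp only [hq, hw, Prod.snd_add, Prod.smul_snd, smul_eq_mul]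
      field_simp
      ring
  have key := h p hp q hrD (s / r) hσ0 hσ1
  rw [hwq] at key
  have hN : (q.1 - p.1) ^ 2 + (q.2 - p.2) ^ 2 = r ^ 2 := by
    simp only [hq]
    linear_combination r ^ 2 * hcd
  have hpw : f p ≤ f w := hmin hsD
  rw [hN] at key
  have e1 : (1 - s / r) * f p ≤ (1 - s / r) * f w :=
    mul_le_mul_of_nonneg_left hpw (by linarith)
  have e2 : s / r * (μ * (1 - s / r) * r ^ 2) ≤ s / r * (f q - f w) := by
    linarith
  have e3 := le_of_mul_le_mul_left e2 (by positivity)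
  have e4 : μ * (1 - s / r) * r ^ 2 = μ * (r * (r - s)) := by
    field_simp
  rw [le_div_iff₀ hμ]
  have e5 : r ^ 2 - s ^ 2 ≤ 2 * (r * (r - s)) := by nlinarith
  have e6 := mul_le_mul_of_nonneg_right e5 hμ.le
  linarith

theorem isCompact_disc (ρ : ℝ) : IsCompact {p : ℝ × ℝ | p.1 ^ 2 + p.2 ^ 2 ≤ ρ ^ 2} := by
  refine Metric.isCompact_of_isClosed_isBounded
    (isClosed_le (by fun_prop) continuous_const) ?_
  refine (Metric.isBounded_closedBall (x := (0 : ℝ × ℝ)) (r := |ρ|)).subset fun p hp => ?_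
  have hp : p.1 ^ 2 + p.2 ^ 2 ≤ ρ ^ 2 := hp
  rw [mem_closedBall_zero_iff, Prod.norm_def]
  exact max_le (sq_le_sq.1 (by nlinarith)) (sq_le_sq.1 (by nlinarith))

theorem isCompact_slabRegion (a b ρ α β γ t δ : ℝ) :
    IsCompact (slabRegion a b ρ α β γ t δ) := by
  have hc : Continuous fun p : ℝ × ℝ => α * sheet a b p.1 p.2 + β * p.1 + γ * p.2 := by
    have := continuous_sheet a b
    fun_prop
  exact (isCompact_disc ρ).inter_right
    ((isClosed_le continuous_const hc).inter (isClosed_le hc continuous_const))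

theorem abs_fst_le_of_mem_slabRegion {a b ρ α β γ t δ : ℝ} (hρ : 0 ≤ ρ) {p : ℝ × ℝ}
    (hp : p ∈ slabRegion a b ρ α β γ t δ) : |p.1| ≤ ρ :=
  abs_le_of_sq_le_sq (by nlinarith [show p.1 ^ 2 + p.2 ^ 2 ≤ ρ ^ 2 from hp.1]) hρ

theorem abs_snd_le_of_mem_slabRegion {a b ρ α β γ t δ : ℝ} (hρ : 0 ≤ ρ) {p : ℝ × ℝ}
    (hp : p ∈ slabRegion a b ρ α β γ t δ) : |p.2| ≤ ρ :=
  abs_le_of_sq_le_sq (by nlinarith [show p.1 ^ 2 + p.2 ^ 2 ≤ ρ ^ 2 from hp.1]) hρ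

theorem swap_preimage_slabRegion (a b ρ α β γ t δ : ℝ) :
    Prod.swap ⁻¹' slabRegion a b ρ α β γ t δ = slabRegion a b ρ α γ β t δ := by
  ext ⟨u, v⟩
  simp only [slabRegion, mem_preimage, mem_inter_iff, mem_ofPred_eq, Prod.swap_prod_mk,
    sheet_comm a b v u, add_comm (v ^ 2), add_right_comm _ (β * v)]

theorem slabRegion_neg (a b ρ α β γ t δ : ℝ) :
    slabRegion a b ρ (-α) (-β) (-γ) (-(t + δ)) δ = slabRegion a b ρ α β γ t δ := by
  ext ⟨u, v⟩
  simp only [slabRegion, mem_inter_iff, mem_ofPred_eq]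
  refine and_congr_right fun _ => ⟨fun h => ⟨?_, ?_⟩, fun h => ⟨?_, ?_⟩⟩ <;> linarith [h.1, h.2]

theorem volume_slabRegion_le_of_flat {a b ρ α β γ t δ : ℝ} (ha : 0 < a) (hb : 0 < b)
    (hρ : 0 ≤ ρ) (hδ : 0 ≤ δ) (hα : |α| * (a * ρ / b ^ 2) ≤ 1 / 4) (hβ : 1 / 2 ≤ |β|) :
    volume (slabRegion a b ρ α β γ t δ) ≤ ENNReal.ofReal (8 * ρ * δ) := by
  have := volume_le_of_slices (isCompact_slabRegion a b ρ α β γ t δ).measurableSet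
    (ρ := ρ) (d := 4 * δ) (by positivity) (fun p hp => abs_snd_le_of_mem_slabRegion hρ hp) ?_
  · convert this using 2
    ring
  intro u u' v hu hu'
  have hX := abs_sheet_sub_le ha hb (v := v) (abs_fst_le_of_mem_slabRegion hρ hu)
    (abs_fst_le_of_mem_slabRegion hρ hu')
  obtain ⟨-, h1, h2⟩ := hu
  obtain ⟨-, h3, h4⟩ := hu'
  simp only at hX h1 h2 h3 h4
  have hXα : |α * (sheet a b u v - sheet a b u' v)| ≤ 1 / 4 * |u - u'| := by
    rw [abs_mul]
    calc _ ≤ |α| * (a * ρ / b ^ 2 * |u - u'|) := by gcongr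
      _ = |α| * (a * ρ / b ^ 2) * |u - u'| := by ring
      _ ≤ _ := by gcongr
  have hf : |α * (sheet a b u v - sheet a b u' v) + β * (u - u')| ≤ δ :=
    abs_le.2 ⟨by linarith, by linarith⟩
  have hβu : |β * (u - u')| ≤ δ + 1 / 4 * |u - u'| := by
    have := abs_sub (α * (sheet a b u v - sheet a b u' v) + β * (u - u'))
      (α * (sheet a b u v - sheet a b u' v))
    rw [add_sub_cancel_left] at this
    linarith
  rw [abs_mul] at hβu
  nlinarith [mul_le_mul_of_nonneg_right hβ (abs_nonneg (u - u'))]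

theorem volume_slabRegion_le_of_curved {a b ρ α β γ t δ : ℝ} (ha : 0 < a) (hb : 0 < b)
    (hρ : 0 < ρ) (hρb : ρ ^ 2 ≤ 8 * b ^ 2) (hδ : 0 ≤ δ)
    (hα : 1 / 4 ≤ α * (a * ρ / b ^ 2)) :
    volume (slabRegion a b ρ α β γ t δ) ≤ ENNReal.ofReal (1728 * ρ * δ) := by
  have hα0 : 0 < α := pos_of_mul_pos_left (by linarith) (by positivity : 0 ≤ a * ρ / b ^ 2)
  have hμ : 0 < α * (a / (54 * b ^ 2)) := by positivity
  have hc : Continuous fun p : ℝ × ℝ => α * sheet a b p.1 p.2 + β * p.1 + γ * p.2 := by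
    have := continuous_sheet a b
    fun_prop
  refine (volume_slab_le_of_strongConvex (isCompact_disc ρ) hc hμ hδ ?_ ?_).trans ?_
  · rintro ⟨u, v⟩ hp ⟨u', v'⟩ hq s hs hs'
    simp only [mem_ofPred_eq, Prod.fst_add, Prod.smul_fst, smul_eq_mul, Prod.snd_add,
      Prod.smul_snd] at hp hq ⊢
    exact sq_add_sq_segment_le hp hq hs hs'
  · rintro ⟨u, v⟩ hp ⟨u', v'⟩ hq s hs hs'
    simp only [mem_ofPred_eq, Prod.fst_add, Prod.smul_fst, smul_eq_mul, Prod.snd_add,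
      Prod.smul_snd] at hp hq ⊢
    have := mul_le_mul_of_nonneg_left
      (sheet_strongConvex ha hb (hp.trans hρb) (hq.trans hρb) hs hs') hα0.le
    linear_combination this
  · refine ENNReal.ofReal_le_ofReal ?_
    have h1 : 2 * δ / (α * (a / (54 * b ^ 2))) ≤ 432 * ρ * δ := by
      rw [div_le_iff₀ hμ]
      have e : 432 * ρ * δ * (α * (a / (54 * b ^ 2))) = 8 * δ * (α * (a * ρ / b ^ 2)) := by
        field_simp
        ring
      rw [e]
      nlinarith
    have h2 : 0 ≤ 2 * δ / (α * (a / (54 * b ^ 2))) := by positivity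
    calc _ ≤ 4 * (432 * ρ * δ) := mul_le_mul Real.pi_le_four h1 h2 (by norm_num)
      _ = _ := by ring

theorem volume_slabRegion_le {a b ρ α β γ t δ : ℝ} (ha : 0 < a) (hb : 0 < b)
    (hρ : b ^ 2 / a ≤ ρ) (hρb : ρ ^ 2 ≤ 8 * b ^ 2) (hδ : 0 ≤ δ)
    (hn : α ^ 2 + β ^ 2 + γ ^ 2 = 1) :
    volume (slabRegion a b ρ α β γ t δ) ≤ ENNReal.ofReal (1728 * ρ * δ) := by
  have hρ0 : 0 < ρ := lt_of_lt_of_le (by positivity) hρ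
  rcases le_total (|α| * (a * ρ / b ^ 2)) (1 / 4) with hα | hα
  · have hk : 1 ≤ a * ρ / b ^ 2 := by
      rw [le_div_iff₀ (by positivity), one_mul, mul_comm]
      exact (div_le_iff₀ ha).1 hρ
    have hα4 : |α| ≤ 1 / 4 := (le_mul_of_one_le_right (abs_nonneg α) hk).trans hα
    have hα2 : α ^ 2 ≤ 1 / 16 := by
      rw [← sq_abs]
      nlinarith [abs_nonneg α]
    have h8 : ENNReal.ofReal (8 * ρ * δ) ≤ ENNReal.ofReal (1728 * ρ * δ) := by
      gcongr
      norm_num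
    refine le_trans ?_ h8
    rcases le_total (1 / 2) |β| with hβ | hβ
    · exact volume_slabRegion_le_of_flat ha hb hρ0.le hδ hα hβ
    · have hγ : 1 / 2 ≤ |γ| := by
        refine le_of_sq_le_sq ?_ (abs_nonneg γ)
        have : |β| ^ 2 ≤ (1 / 2) ^ 2 := by gcongr
        rw [sq_abs] at this ⊢
        linarith
      have := volume_slabRegion_le_of_flat (γ := β) (t := t) ha hb hρ0.le hδ hα hγ
      rw [← swap_preimage_slabRegion] at this
      rwa [Measure.volume_eq_prod, Measure.measurePreserving_swap.measure_preimage
        (isCompact_slabRegion a b ρ α β γ t δ).measurableSet.nullMeasurableSet] at this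
  · rcases le_total 0 α with h0 | h0
    · rw [abs_of_nonneg h0] at hα
      exact volume_slabRegion_le_of_curved ha hb hρ0 hρb hδ hα
    · rw [abs_of_nonpos h0] at hα
      rw [← slabRegion_neg]
      exact volume_slabRegion_le_of_curved ha hb hρ0 hρb hδ hα

theorem E3.dist_le (p q : E3) : dist p q ≤ |p 0 - q 0| + |p 1 - q 1| + |p 2 - q 2| := by
  rw [EuclideanSpace.dist_eq, Fin.sum_univ_three]
  simp only [Real.dist_eq]
  refine Real.sqrt_le_iff.2 ⟨by positivity, ?_⟩
  nlinarith [mul_nonneg (abs_nonneg (p 0 - q 0)) (abs_nonneg (p 1 - q 1)),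
    mul_nonneg (abs_nonneg (p 0 - q 0)) (abs_nonneg (p 2 - q 2)),
    mul_nonneg (abs_nonneg (p 1 - q 1)) (abs_nonneg (p 2 - q 2))]

/-- The part of the surface near the apex is a Lipschitz graph over the plane orthogonal to the
axis. -/
theorem hausdorffMeasure_core_le {a b ρ α β γ t δ : ℝ} (ha : 0 < a) (hb : 0 < b)
    (hρ : b ^ 2 / a ≤ ρ) (hρb : ρ ^ 2 ≤ 8 * b ^ 2) (hδ : 0 ≤ δ)
    (hn : α ^ 2 + β ^ 2 + γ ^ 2 = 1) {Q : Set E3}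
    (hQ : ∀ p ∈ Q, p 0 = sheet a b (p 1) (p 2) ∧ (p 1, p 2) ∈ slabRegion a b ρ α β γ t δ ∧
      p 1 ^ 2 + p 2 ^ 2 ≤ (b ^ 2 / a) ^ 2) :
    μH[2] Q ≤ ENNReal.ofReal (16 * 1728 * ρ * δ) := by
  have hk : 0 ≤ b ^ 2 / a := by positivity
  have hdist : ∀ p ∈ Q, ∀ q ∈ Q,
      dist p q ≤ (4 : NNReal) * dist ((p 1, p 2) : ℝ × ℝ) (q 1, q 2) := by
    intro p hp q hq
    obtain ⟨hp0, -, hpk⟩ := hQ p hp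
    obtain ⟨hq0, -, hqk⟩ := hQ q hq
    have hk1 : a * (b ^ 2 / a) / b ^ 2 = 1 := by field_simp
    have h1 := abs_sheet_sub_le ha hb (u := p 1) (u' := q 1) (v := p 2) (ρ := b ^ 2 / a)
      (abs_le_of_sq_le_sq (by nlinarith) hk) (abs_le_of_sq_le_sq (by nlinarith) hk)
    have h2 := abs_sheet_sub_le ha hb (u := p 2) (u' := q 2) (v := q 1) (ρ := b ^ 2 / a)
      (abs_le_of_sq_le_sq (by nlinarith) hk) (abs_le_of_sq_le_sq (by nlinarith) hk)
    rw [hk1, one_mul] at h1 h2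
    rw [sheet_comm a b (p 2), sheet_comm a b (q 2)] at h2
    have h3 := abs_sub_le (sheet a b (p 1) (p 2)) (sheet a b (q 1) (p 2)) (sheet a b (q 1) (q 2))
    rw [← hp0, ← hq0] at h3
    have h4 := E3.dist_le p q
    have h5 : |p 1 - q 1| ≤ dist ((p 1, p 2) : ℝ × ℝ) (q 1, q 2) := le_max_left _ _
    have h6 : |p 2 - q 2| ≤ dist ((p 1, p 2) : ℝ × ℝ) (q 1, q 2) := le_max_right _ _
    rw [← hp0] at h1
    rw [← hq0] at h2
    push_cast
    linarith
  have := hausdorffMeasure_le_of_dist_le (d := 2) (f := fun p : E3 => ((p 1, p 2) : ℝ × ℝ))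
    zero_le_two hdist (t := slabRegion a b ρ α β γ t δ) fun p hp => (hQ p hp).2.1
  rw [hausdorffMeasure_prod_real] at this
  refine this.trans ?_
  calc _ ≤ ENNReal.ofReal 16 * ENNReal.ofReal (1728 * ρ * δ) := by
        gcongr
        · rw [ENNReal.rpow_two, ← ENNReal.ofReal_coe_nnreal, ← ENNReal.ofReal_pow (by positivity)]
          norm_num
        · exact volume_slabRegion_le ha hb hρ hρb hδ hn
    _ = _ := by
        rw [← ENNReal.ofReal_mul (by norm_num)]
        congr 1
        ring

/-- Away from the apex, the part of the surface on which the coordinate `u` transverse to the axis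
dominates the other one, `v`, is a Lipschitz graph over the plane spanned by the axis and the
direction of `v`. -/
theorem hausdorffMeasure_patch_le {a b ρ α β γ t δ : ℝ} (ha : 0 < a) (hb : 0 < b)
    (hρ : b ^ 2 / a ≤ ρ) (hρb : ρ ^ 2 ≤ 8 * b ^ 2) (hδ : 0 ≤ δ)
    (hn : α ^ 2 + β ^ 2 + γ ^ 2 = 1) {Q : Set E3} (u v : E3 → ℝ)
    (huv : ∀ p q, dist p q ≤ |p 0 - q 0| + |u p - u q| + |v p - v q|)
    (hQ : ∀ p ∈ Q, p 0 = sheet a b (u p) (v p) ∧ (u p, v p) ∈ slabRegion a b ρ α β γ t δ ∧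
      |v p| ≤ u p ∧ (b ^ 2 / a) ^ 2 ≤ u p ^ 2 + v p ^ 2) :
    μH[2] Q ≤ ENNReal.ofReal (81 * 1728 * (a * ρ ^ 2 / b ^ 2) * δ) := by
  have hk : 0 < b ^ 2 / a := by positivity
  have hρ0 : 0 < ρ := hk.trans_le hρ
  have hlow : ∀ p ∈ Q, b ^ 2 / a / 2 ≤ u p := by
    intro p hp
    obtain ⟨-, -, hv, hr⟩ := hQ p hp
    have hu : 0 ≤ u p := (abs_nonneg _).trans hv
    refine le_of_sq_le_sq ?_ hu
    have : v p ^ 2 ≤ u p ^ 2 := sq_le_sq.2 (by rwa [abs_of_nonneg hu])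
    nlinarith
  have hdist : ∀ p ∈ Q, ∀ q ∈ Q,
      dist p q ≤ (9 : NNReal) * dist ((p 0, v p) : ℝ × ℝ) (q 0, v q) := by
    intro p hp q hq
    obtain ⟨hp0, hpT, hpv, -⟩ := hQ p hp
    obtain ⟨hq0, hqT, hqv, -⟩ := hQ q hq
    have hpl := hlow p hp
    have hql := hlow q hq
    have h1 := sheet_sq (a := a) hb (u p) (v p)
    have h2 := sheet_sq (a := a) hb (u q) (v q)
    have m1 := sheet_le ha hb (show u p ^ 2 + v p ^ 2 ≤ _ from hpT.1.trans hρb)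
    have m2 := sheet_le ha hb (show u q ^ 2 + v q ^ 2 ≤ _ from hqT.1.trans hρb)
    have l1 := le_sheet b ha (u p) (v p)
    have l2 := le_sheet b ha (u q) (v q)
    rw [← hp0] at h1 m1 l1
    rw [← hq0] at h2 m2 l2
    have hsum : b ^ 2 / a ≤ u p + u q := by linarith
    have hsum0 : 0 < u p + u q := hk.trans_le hsum
    have e : (u p + u q) * (u p - u q)
        = b ^ 2 / a ^ 2 * (p 0 + q 0) * (p 0 - q 0) - (v p + v q) * (v p - v q) := by
      field_simp
      linear_combination h2 - h1
    have hvv : |v p + v q| ≤ u p + u q := (abs_add_le _ _).trans (by linarith)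
    have hxx : b ^ 2 / a ^ 2 * (p 0 + q 0) ≤ 6 * (u p + u q) := by
      calc _ ≤ b ^ 2 / a ^ 2 * (6 * a) := by gcongr; linarith
        _ = 6 * (b ^ 2 / a) := by field_simp
        _ ≤ _ := by gcongr
    have hmain : (u p + u q) * |u p - u q| ≤
        (u p + u q) * (6 * |p 0 - q 0| + |v p - v q|) := by
      have hx0 : 0 ≤ b ^ 2 / a ^ 2 * (p 0 + q 0) := mul_nonneg (by positivity) (by linarith)
      calc (u p + u q) * |u p - u q| = |(u p + u q) * (u p - u q)| := by
            rw [abs_mul, abs_of_pos hsum0]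
        _ ≤ b ^ 2 / a ^ 2 * (p 0 + q 0) * |p 0 - q 0| + |v p + v q| * |v p - v q| := by
            rw [e]
            refine (abs_sub _ _).trans (le_of_eq ?_)
            rw [abs_mul _ (p 0 - q 0), abs_of_nonneg hx0, abs_mul (v p + v q)]
        _ ≤ 6 * (u p + u q) * |p 0 - q 0| + (u p + u q) * |v p - v q| := by gcongr
        _ = _ := by ring
    have h3 := le_of_mul_le_mul_left hmain hsum0
    have h4 := huv p q
    have h5 : |p 0 - q 0| ≤ dist ((p 0, v p) : ℝ × ℝ) (q 0, v q) := le_max_left _ _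
    have h6 : |v p - v q| ≤ dist ((p 0, v p) : ℝ × ℝ) (q 0, v q) := le_max_right _ _
    push_cast
    linarith
  set M : NNReal := ⟨a * ρ / b ^ 2, by positivity⟩ with hM
  have hproj := hausdorffMeasure_le_of_dist_le (d := 2) (f := fun p : E3 => ((p 0, v p) : ℝ × ℝ))
    zero_le_two hdist
    (t := (fun p : ℝ × ℝ => (sheet a b p.1 p.2, p.2)) '' slabRegion a b ρ α β γ t δ)
    fun p hp => ⟨(u p, v p), (hQ p hp).2.1, by simp [(hQ p hp).1]⟩
  have himg := volume_image_shear_le (isCompact_slabRegion a b ρ α β γ t δ)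
    (continuous_sheet a b) (M := M) fun x x' y hx hx' =>
      abs_sheet_sub_le ha hb (abs_fst_le_of_mem_slabRegion hρ0.le hx)
        (abs_fst_le_of_mem_slabRegion hρ0.le hx')
  rw [hausdorffMeasure_prod_real] at hproj
  refine hproj.trans ?_
  calc _ ≤ ENNReal.ofReal 81 *
        (ENNReal.ofReal (a * ρ / b ^ 2) * ENNReal.ofReal (1728 * ρ * δ)) := by
        gcongr
        · rw [ENNReal.rpow_two, ← ENNReal.ofReal_coe_nnreal, ← ENNReal.ofReal_pow (by positivity)]
          norm_num
        · refine himg.trans ?_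
          gcongr
          · rw [← ENNReal.ofReal_coe_nnreal]
            exact le_rfl
          · exact volume_slabRegion_le ha hb hρ hρb hδ hn
    _ = _ := by
        rw [← ENNReal.ofReal_mul (by positivity), ← ENNReal.ofReal_mul (by norm_num)]
        congr 1
        ring

/-- The part of the hyperboloid within distance `R ≤ a` of a focus lies on the right sheet, above
a disc of radius comparable to `b * √(R / a)`. -/
theorem hyperboloid_inter_ball {a b R x y z : ℝ} (hb : 0 < b) (hba : b ≤ a)
    (hR : b ^ 2 / a ≤ R) (hRa : R ≤ a) (hS : x ^ 2 / a ^ 2 - (y ^ 2 + z ^ 2) / b ^ 2 = 1)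
    (hB : |x - √(a ^ 2 + b ^ 2)| ≤ R) :
    x = sheet a b y z ∧ y ^ 2 + z ^ 2 ≤ 8 * b ^ 2 / a * R := by
  have ha : 0 < a := hb.trans_le hba
  have hc : a < √(a ^ 2 + b ^ 2) := Real.lt_sqrt_of_sq_lt (by nlinarith)
  have hc' : √(a ^ 2 + b ^ 2) ≤ a + b ^ 2 / a := by
    refine Real.sqrt_le_iff.2 ⟨by positivity, ?_⟩
    have : (a + b ^ 2 / a) ^ 2 = a ^ 2 + 2 * b ^ 2 + (b ^ 2 / a) ^ 2 := by
      field_simp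
      ring
    nlinarith [sq_nonneg (b ^ 2 / a), sq_nonneg b]
  obtain ⟨h1, h2⟩ := abs_le.1 hB
  have hx : 0 < x := by linarith
  have hS' : b ^ 2 * x ^ 2 = a ^ 2 * (b ^ 2 + (y ^ 2 + z ^ 2)) := by
    field_simp at hS
    linear_combination hS
  have hsh := sheet_sq (a := a) hb y z
  have hxs : x = sheet a b y z := by
    rw [← hS'] at hsh
    have := mul_left_cancel₀ (by positivity) hsh
    exact ((pow_left_inj₀ (ha.le.trans (le_sheet b ha y z)) hx.le two_ne_zero).1 this).symm
  refine ⟨hxs, ?_⟩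
  have hxa : a ≤ x := hxs ▸ le_sheet b ha y z
  have h3 : (x - a) * (x + a) ≤ 2 * R * (4 * a) := by
    apply mul_le_mul <;> linarith
  have h4 : y ^ 2 + z ^ 2 = b ^ 2 / a ^ 2 * ((x - a) * (x + a)) := by
    field_simp
    linear_combination -hS'
  calc _ ≤ b ^ 2 / a ^ 2 * (2 * R * (4 * a)) := by rw [h4]; gcongr
    _ = _ := by field_simp; ring

/-- Area of intersection of a hyperboloid of revolution with a ball centered at a focus
and a thickened plane. -/
theorem hyperboloid_ball_plane_area :
    ∃ C > (0 : ℝ), ∀ (a b : ℝ), 0 < b → b ≤ a →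
      ∀ (R : ℝ), b ^ 2 / a ≤ R → R ≤ a →
      ∀ (δ : ℝ), 0 < δ →
      ∀ (n : E3), ‖n‖ = 1 → ∀ (t : ℝ),
      μH[2] ({x : E3 | (x 0) ^ 2 / a ^ 2 - ((x 1) ^ 2 + (x 2) ^ 2) / b ^ 2 = 1}
          ∩ Metric.closedBall
              ((WithLp.equiv 2 ((i : Fin 3) → ℝ)).symm ![Real.sqrt (a ^ 2 + b ^ 2), 0, 0]) R
          ∩ {x : E3 | t ≤ ⟪x, n⟫_ℝ ∧ ⟪x, n⟫_ℝ ≤ t + δ})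
        ≤ ENNReal.ofReal (C * R * δ) := by
  refine ⟨10 ^ 7, by norm_num, fun a b hb hba R hR hRa δ hδ n hn t => ?_⟩
  have ha : 0 < a := hb.trans_le hba
  have hk : 0 < b ^ 2 / a := by positivity
  have hR0 : 0 < R := hk.trans_le hR
  set ρ := √(8 * b ^ 2 / a * R) with hρdef
  have hρsq : ρ ^ 2 = 8 * b ^ 2 / a * R := Real.sq_sqrt (by positivity)
  have hρsq' : ρ ^ 2 = 8 * (b ^ 2 / a * R) := by rw [hρsq]; ring
  have hρk : b ^ 2 / a ≤ ρ := Real.le_sqrt_of_sq_le (by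
    have : (b ^ 2 / a) ^ 2 ≤ b ^ 2 / a * R := by rw [sq]; gcongr
    have e : 8 * b ^ 2 / a * R = 8 * (b ^ 2 / a * R) := by ring
    nlinarith [mul_pos hk hR0])
  have hρ0 : 0 < ρ := hk.trans_le hρk
  have hρb : ρ ^ 2 ≤ 8 * b ^ 2 := by
    rw [hρsq]
    calc _ ≤ 8 * b ^ 2 / a * a := by gcongr
      _ = _ := by field_simp
  have hρR : ρ ≤ 3 * R := by
    refine le_of_sq_le_sq ?_ (by positivity)
    have : b ^ 2 / a * R ≤ R * R := by gcongr
    rw [hρsq']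
    nlinarith
  have hn1 : n 0 ^ 2 + n 1 ^ 2 + n 2 ^ 2 = 1 := by
    have := EuclideanSpace.real_norm_sq_eq n
    rw [hn, Fin.sum_univ_three] at this
    linarith
  set Q := {x : E3 | (x 0) ^ 2 / a ^ 2 - ((x 1) ^ 2 + (x 2) ^ 2) / b ^ 2 = 1}
          ∩ Metric.closedBall
              ((WithLp.equiv 2 ((i : Fin 3) → ℝ)).symm ![Real.sqrt (a ^ 2 + b ^ 2), 0, 0]) R
          ∩ {x : E3 | t ≤ ⟪x, n⟫_ℝ ∧ ⟪x, n⟫_ℝ ≤ t + δ} with hQdef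
  have hQ : ∀ p ∈ Q, p 0 = sheet a b (p 1) (p 2) ∧ p 1 ^ 2 + p 2 ^ 2 ≤ ρ ^ 2 ∧
      t ≤ n 0 * p 0 + n 1 * p 1 + n 2 * p 2 ∧ n 0 * p 0 + n 1 * p 1 + n 2 * p 2 ≤ t + δ := by
    rintro p ⟨⟨hS, hB⟩, hP⟩
    have hB' : |p 0 - √(a ^ 2 + b ^ 2)| ≤ R := by
      have h1 := PiLp.norm_apply_le (p - (WithLp.equiv 2 ((i : Fin 3) → ℝ)).symm
        ![Real.sqrt (a ^ 2 + b ^ 2), 0, 0]) 0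
      rw [← dist_eq_norm] at h1
      exact h1.trans (Metric.mem_closedBall.1 hB)
    obtain ⟨h1, h2⟩ := hyperboloid_inter_ball hb hba hR hRa hS hB'
    have hin : ⟪p, n⟫_ℝ = n 0 * p 0 + n 1 * p 1 + n 2 * p 2 := by
      simp [PiLp.inner_apply, Fin.sum_univ_three]
    simp only [mem_ofPred_eq, hin] at hP
    exact ⟨h1, hρsq ▸ h2, hP⟩
  set k := b ^ 2 / a with hkdef
  set far := {p : E3 | k ^ 2 ≤ p 1 ^ 2 + p 2 ^ 2}
  have hcore : μH[2] (Q ∩ {p : E3 | p 1 ^ 2 + p 2 ^ 2 ≤ k ^ 2}) ≤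
      ENNReal.ofReal (16 * 1728 * ρ * δ) := by
    refine hausdorffMeasure_core_le (t := t) ha hb hρk hρb hδ.le hn1 fun p hp => ?_
    obtain ⟨h0, h1, h2⟩ := hQ p hp.1
    exact ⟨h0, ⟨h1, by simpa only [mem_ofPred_eq, ← h0] using h2⟩, hp.2⟩
  have hpatch : ∀ (σ : ℝ), σ ^ 2 = 1 →
      μH[2] (Q ∩ far ∩ {p | |p 2| ≤ σ * p 1}) ≤
        ENNReal.ofReal (81 * 1728 * (a * ρ ^ 2 / b ^ 2) * δ) ∧
      μH[2] (Q ∩ far ∩ {p | |p 1| ≤ σ * p 2}) ≤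
        ENNReal.ofReal (81 * 1728 * (a * ρ ^ 2 / b ^ 2) * δ) := by
    intro σ hσ
    have hσ1 : |σ| = 1 := by simpa using (sq_eq_sq_iff_abs_eq_abs σ 1).1 (by simpa using hσ)
    have hσs : ∀ x y : ℝ, |σ * x - σ * y| = |x - y| := fun x y => by
      rw [← mul_sub, abs_mul, hσ1, one_mul]
    have hsq : ∀ x : ℝ, (σ * x) ^ 2 = x ^ 2 := fun x => by rw [mul_pow, hσ, one_mul]
    have hsh : ∀ x y : ℝ, sheet a b (σ * x) y = sheet a b x y := fun x y => by
      unfold sheet; rw [hsq]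
    have hσσ : ∀ x y : ℝ, σ * x * (σ * y) = x * y := fun x y => by
      linear_combination x * y * hσ
    constructor
    · refine hausdorffMeasure_patch_le (α := n 0) (β := σ * n 1) (γ := n 2) (t := t) ha hb hρk hρb
        hδ.le (by rw [hsq, hn1]) (fun p => σ * p 1) (fun p => p 2) (fun p q => ?_) fun p hp => ?_
      · rw [hσs]
        exact E3.dist_le p q
      · obtain ⟨⟨hpQ, hpf⟩, hp⟩ := hp
        obtain ⟨h0, h1, h2⟩ := hQ p hpQ
        refine ⟨by rw [hsh, ← h0], ⟨?_, ?_⟩, hp, ?_⟩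
        · simpa only [mem_ofPred_eq, hsq] using h1
        · simpa only [mem_ofPred_eq, hsh, ← h0, hσσ] using h2
        · rw [hsq]
          exact hpf
    · refine hausdorffMeasure_patch_le (α := n 0) (β := σ * n 2) (γ := n 1) (t := t) ha hb hρk hρb
        hδ.le (by rw [hsq]; linarith) (fun p => σ * p 2) (fun p => p 1) (fun p q => ?_)
        fun p hp => ?_
      · rw [hσs]
        linarith [E3.dist_le p q]
      · obtain ⟨⟨hpQ, hpf⟩, hp⟩ := hp
        obtain ⟨h0, h1, h2⟩ := hQ p hpQ
        refine ⟨by rw [hsh, sheet_comm, ← h0], ⟨?_, ?_⟩, hp, ?_⟩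
        · simpa only [mem_ofPred_eq, hsq, add_comm (p 2 ^ 2)] using h1
        · simpa only [mem_ofPred_eq, hsh, sheet_comm a b (p 2), ← h0, hσσ,
            add_right_comm _ (n 2 * p 2)] using h2
        · rw [hsq, add_comm]
          exact hpf
  have hcover : Q ⊆ Q ∩ {p : E3 | p 1 ^ 2 + p 2 ^ 2 ≤ k ^ 2} ∪
      (((Q ∩ far ∩ {p | |p 2| ≤ 1 * p 1}) ∪ (Q ∩ far ∩ {p | |p 1| ≤ 1 * p 2})) ∪
      ((Q ∩ far ∩ {p | |p 2| ≤ -1 * p 1}) ∪ (Q ∩ far ∩ {p | |p 1| ≤ -1 * p 2}))) := by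
    intro p hp
    rcases le_total (p 1 ^ 2 + p 2 ^ 2) (k ^ 2) with h | h
    · exact Or.inl ⟨hp, h⟩
    refine Or.inr ?_
    rcases le_total |p 2| |p 1| with h' | h'
    · rcases abs_cases (p 1) with ⟨e, -⟩ | ⟨e, -⟩
      · exact Or.inl (Or.inl ⟨⟨hp, h⟩, by simpa [e] using h'⟩)
      · exact Or.inr (Or.inl ⟨⟨hp, h⟩, by simpa [e] using h'⟩)
    · rcases abs_cases (p 2) with ⟨e, -⟩ | ⟨e, -⟩
      · exact Or.inl (Or.inr ⟨⟨hp, h⟩, by simpa [e] using h'⟩)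
      · exact Or.inr (Or.inr ⟨⟨hp, h⟩, by simpa [e] using h'⟩)
  obtain ⟨hp1, hp2⟩ := hpatch 1 (by norm_num)
  obtain ⟨hp3, hp4⟩ := hpatch (-1) (by norm_num)
  have hpos : 0 ≤ 81 * 1728 * (a * ρ ^ 2 / b ^ 2) * δ := by positivity
  calc μH[2] Q ≤ _ := measure_mono hcover
    _ ≤ _ := (measure_union_le _ _).trans (add_le_add hcore
        ((measure_union_le _ _).trans (add_le_add
          ((measure_union_le _ _).trans (add_le_add hp1 hp2))
          ((measure_union_le _ _).trans (add_le_add hp3 hp4)))))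
    _ ≤ _ := by
        rw [← ENNReal.ofReal_add hpos hpos, ← ENNReal.ofReal_add (by positivity) (by positivity),
          ← ENNReal.ofReal_add (by positivity) (by positivity)]
        refine ENNReal.ofReal_le_ofReal ?_
        have e : a * ρ ^ 2 / b ^ 2 = 8 * R := by
          rw [hρsq]
          field_simp
        rw [e]
        nlinarith [mul_le_mul_of_nonneg_right hρR hδ.le, mul_pos hR0 hδ]
end
end

section
/- There is a universal constant C > 0 with the following property. Let N, d > 0, ω₀ ∈ 𝕊², and 0 < γ < γ' < 1. Let Ω ⊂ 𝕊² be a γ-separated set, i.e. ∠(ω, ω') ≥ γ for all distinct ω, ω' ∈ Ω. Then for every (τ, ξ) ∈ ℝ × ℝ³ with N/2 ≤ |ξ| ≤ 2N, the number of ω ∈ Ω such that ∠(ω, ω₀) ≤ γ' and |−τ + ξ·ω| ≤ d is at most C(γ'/γ + d/(Nγ²)). -/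
open MeasureTheory Set
open scoped ENNReal InnerProductSpace

noncomputable section

/-- A finite set on which two real coordinates jointly separate points at scales `s` and `t`
has at most as many elements as there are cells of an `s × t` grid. -/
theorem card_le_of_separated_pair {α : Type*} (S : Finset α) (u v : α → ℝ) {A B s t : ℝ}
    (hA : 0 ≤ A) (hB : 0 ≤ B) (hs : 0 < s) (ht : 0 < t)
    (hu : ∀ p ∈ S, ∀ q ∈ S, |u p - u q| ≤ A) (hv : ∀ p ∈ S, ∀ q ∈ S, |v p - v q| ≤ B)
    (hsep : ∀ p ∈ S, ∀ q ∈ S, |u p - u q| < s → |v p - v q| < t → p = q) :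
    (S.card : ℝ) ≤ (A / s + 1) * (B / t + 1) := by
  rcases S.eq_empty_or_nonempty with rfl | hne
  · simp only [Finset.card_empty, Nat.cast_zero]
    positivity
  obtain ⟨a, ha, hau⟩ := S.exists_min_image u hne
  obtain ⟨b, hb, hbv⟩ := S.exists_min_image v hne
  have hcard : S.card ≤
      (Finset.range (⌊A / s⌋₊ + 1) ×ˢ Finset.range (⌊B / t⌋₊ + 1)).card := by
    apply Finset.card_le_card_of_injOn
      (fun p => (⌊(u p - u a) / s⌋₊, ⌊(v p - v b) / t⌋₊))
    · intro p hp
      simp only [Finset.coe_product, Finset.coe_range, Set.mem_prod, Set.mem_Iio, Nat.lt_succ_iff]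
      constructor
      · apply Nat.floor_le_floor
        gcongr
        exact (le_abs_self _).trans (hu p hp a ha)
      · apply Nat.floor_le_floor
        gcongr
        exact (le_abs_self _).trans (hv p hp b hb)
    · intro p hp q hq hpq
      simp only [Prod.mk.injEq] at hpq
      have key : ∀ x y c r : ℝ, 0 < r → c ≤ x → c ≤ y →
          ⌊(x - c) / r⌋₊ = ⌊(y - c) / r⌋₊ → |x - y| < r := by
        intro x y c r hr hx hy h
        have hx0 : 0 ≤ (x - c) / r := div_nonneg (by linarith) hr.le
        have hy0 : 0 ≤ (y - c) / r := div_nonneg (by linarith) hr.le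
        have h1 := Nat.floor_le hx0
        have h2 := Nat.lt_floor_add_one ((x - c) / r)
        have h3 := Nat.floor_le hy0
        have h4 := Nat.lt_floor_add_one ((y - c) / r)
        rw [h] at h1 h2
        have h5 : |(x - c) / r - (y - c) / r| < 1 := by
          rw [abs_lt]; constructor <;> linarith
        rwa [← sub_div, abs_div, abs_of_pos hr, div_lt_one hr, sub_sub_sub_cancel_right] at h5
      exact hsep p hp q hq (key _ _ _ _ hs (hau p hp) (hau q hq) hpq.1)
        (key _ _ _ _ ht (hbv p hp) (hbv q hq) hpq.2)
  rw [Finset.card_product, Finset.card_range, Finset.card_range] at hcard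
  calc (S.card : ℝ) ≤ ((⌊A / s⌋₊ + 1) * (⌊B / t⌋₊ + 1) : ℝ) := by exact_mod_cast hcard
    _ ≤ (A / s + 1) * (B / t + 1) := by
      gcongr
      · exact Nat.floor_le (by positivity)
      · exact Nat.floor_le (by positivity)

/-- Counting separated points of the unit sphere, in a quarter where `x` dominates `y`, at
distance about `ρ` from the `z`-axis: there `y` and `z` are good coordinates. -/
theorem card_le_of_side_region {α : Type*} (S : Finset α) (x y z : α → ℝ) {γ γ' h ρ : ℝ}
    (hγ : 0 < γ) (hγγ' : γ < γ') (hh : 0 ≤ h) (hγρ : γ ≤ ρ) (hρ : ρ ≤ 1)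
    (hsph : ∀ p ∈ S, x p ^ 2 + y p ^ 2 + z p ^ 2 = 1)
    (hsep : ∀ p ∈ S, ∀ q ∈ S, p ≠ q →
      2 / 5 * γ ^ 2 ≤ (x p - x q) ^ 2 + (y p - y q) ^ 2 + (z p - z q) ^ 2)
    (hy : ∀ p ∈ S, ∀ q ∈ S, |y p - y q| ≤ 2 * γ')
    (hz : ∀ p ∈ S, ∀ q ∈ S, |z p - z q| ≤ h)
    (hle : ∀ p ∈ S, x p ^ 2 + y p ^ 2 ≤ ρ ^ 2)
    (hge : ∀ p ∈ S, ρ ^ 2 / 4 ≤ x p ^ 2 + y p ^ 2)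
    (hdom : ∀ p ∈ S, |y p| ≤ x p) :
    (S.card : ℝ) ≤ 21 * (γ' / γ) + 210 * (h / γ ^ 2) := by
  have hρ0 : 0 < ρ := hγ.trans_le hγρ
  have hyρ : ∀ p ∈ S, |y p| ≤ ρ := fun p hp =>
    abs_le_of_sq_le_sq (by nlinarith [hle p hp, sq_nonneg (x p)]) hρ0.le
  have hx : ∀ p ∈ S, ρ / 3 ≤ x p := by
    intro p hp
    have h0 : 0 ≤ x p := (abs_nonneg _).trans (hdom p hp)
    have h1 : y p ^ 2 ≤ x p ^ 2 := sq_le_sq.2 ((hdom p hp).trans (le_abs_self _))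
    exact le_of_sq_le_sq (by nlinarith [hge p hp]) h0
  have hz1 : ∀ p ∈ S, |z p| ≤ 1 := fun p hp =>
    abs_le_of_sq_le_sq (by nlinarith [hsph p hp, sq_nonneg (x p), sq_nonneg (y p)]) zero_le_one
  have hcount := card_le_of_separated_pair S y z (A := min (2 * γ') (2 * ρ)) (B := h)
    (s := γ / 10) (t := γ / 10 * ρ) (le_min (by linarith) (by linarith)) hh (by positivity)
    (by positivity)
    (fun p hp q hq => le_min (hy p hp q hq) ((abs_sub _ _).trans
      (by linarith [hyρ p hp, hyρ q hq]))) hz ?_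
  · set A := min (2 * γ') (2 * ρ)
    have hA0 : 0 ≤ A := le_min (by linarith) (by linarith)
    have hA1 : A ≤ 2 * γ' := min_le_left _ _
    have hA2 : A ≤ 2 * ρ := min_le_right _ _
    have e : (A / (γ / 10) + 1) * (h / (γ / 10 * ρ) + 1) =
        100 * (h / γ ^ 2) * (A / ρ) + 10 * (A / γ) + 10 * (h / γ ^ 2) * (γ / ρ) + 1 := by
      field_simp
      ring
    have b1 : A / ρ ≤ 2 := by rw [div_le_iff₀ hρ0]; exact hA2
    have b2 : A / γ ≤ 2 * (γ' / γ) := by rw [← mul_div_assoc]; gcongr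
    have b3 : γ / ρ ≤ 1 := by rw [div_le_one hρ0]; exact hγρ
    have b4 : 1 ≤ γ' / γ := by rw [one_le_div hγ]; exact hγγ'.le
    have hH : 0 ≤ h / γ ^ 2 := by positivity
    rw [e] at hcount
    nlinarith [mul_le_mul_of_nonneg_left b1 hH, mul_le_mul_of_nonneg_left b3 hH]
  · intro p hp q hq h1 h2
    by_contra hne
    have hs := hsep p hp q hq hne
    have hsum : 2 * (ρ / 3) ≤ x p + x q := by linarith [hx p hp, hx q hq]
    have hsum0 : 0 < x p + x q := by linarith
    have hid : (x p - x q) * (x p + x q) =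
        -((z p - z q) * (z p + z q)) - (y p - y q) * (y p + y q) := by
      linear_combination hsph p hp - hsph q hq
    have hzz : |z p + z q| ≤ 2 := (abs_add_le _ _).trans (by linarith [hz1 p hp, hz1 q hq])
    have hyy : |y p + y q| ≤ x p + x q :=
      (abs_add_le _ _).trans (by linarith [hdom p hp, hdom q hq])
    have hb : |x p - x q| * (x p + x q) ≤ γ / 10 * ρ * 2 + γ / 10 * (x p + x q) := by
      calc |x p - x q| * (x p + x q) = |(x p - x q) * (x p + x q)| := by
            rw [abs_mul, abs_of_pos hsum0]
        _ ≤ |z p - z q| * |z p + z q| + |y p - y q| * |y p + y q| := by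
            rw [hid]
            refine (abs_sub _ _).trans ?_
            rw [abs_neg, abs_mul, abs_mul]
        _ ≤ _ := by gcongr
    have hxx : |x p - x q| ≤ 4 * (γ / 10) := by
      refine le_of_mul_le_mul_right (hb.trans ?_) hsum0
      nlinarith
    have hz2 : |z p - z q| ≤ γ / 10 := h2.le.trans (by nlinarith)
    have k1 := sq_le_sq' (abs_le.1 hxx).1 (abs_le.1 hxx).2
    have k2 := sq_le_sq' (abs_le.1 h1.le).1 (abs_le.1 h1.le).2
    have k3 := sq_le_sq' (abs_le.1 hz2).1 (abs_le.1 hz2).2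
    nlinarith [pow_pos hγ 2]

/-- Counting separated points of the unit sphere near a pole of the `z`-axis: there `x` and `y`
are good coordinates. -/
theorem card_le_of_polar_region {α : Type*} (S : Finset α) (x y z : α → ℝ) {γ ρ : ℝ}
    (hγ : 0 < γ) (hγρ : γ ≤ ρ) (hρ : ρ ≤ 1)
    (hsph : ∀ p ∈ S, x p ^ 2 + y p ^ 2 + z p ^ 2 = 1)
    (hsep : ∀ p ∈ S, ∀ q ∈ S, p ≠ q →
      2 / 5 * γ ^ 2 ≤ (x p - x q) ^ 2 + (y p - y q) ^ 2 + (z p - z q) ^ 2)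
    (hlt : ∀ p ∈ S, x p ^ 2 + y p ^ 2 < ρ ^ 2 / 4)
    (hz : ∀ p ∈ S, 0 ≤ z p) :
    (S.card : ℝ) ≤ 121 * (ρ ^ 2 / γ ^ 2) := by
  have hρ0 : 0 < ρ := hγ.trans_le hγρ
  have hxρ : ∀ p ∈ S, |x p| ≤ ρ / 2 := fun p hp =>
    abs_le_of_sq_le_sq (by nlinarith [hlt p hp, sq_nonneg (y p)]) (by linarith)
  have hyρ : ∀ p ∈ S, |y p| ≤ ρ / 2 := fun p hp =>
    abs_le_of_sq_le_sq (by nlinarith [hlt p hp, sq_nonneg (x p)]) (by linarith)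
  have hz2 : ∀ p ∈ S, 1 / 2 ≤ z p := fun p hp =>
    le_of_sq_le_sq (by nlinarith [hlt p hp, hsph p hp]) (hz p hp)
  have hcount := card_le_of_separated_pair S x y (A := ρ) (B := ρ)
    (s := γ / 10) (t := γ / 10) hρ0.le hρ0.le (by positivity) (by positivity)
    (fun p hp q hq => (abs_sub _ _).trans (by linarith [hxρ p hp, hxρ q hq]))
    (fun p hp q hq => (abs_sub _ _).trans (by linarith [hyρ p hp, hyρ q hq])) ?_
  · have e : ρ / (γ / 10) = 10 * (ρ / γ) := by field_simp
    have b : 1 ≤ ρ / γ := by rw [one_le_div hγ]; exact hγρ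
    rw [e] at hcount
    rw [← div_pow]
    nlinarith
  · intro p hp q hq h1 h2
    by_contra hne
    have hs := hsep p hp q hq hne
    have hsum : 1 ≤ z p + z q := by linarith [hz2 p hp, hz2 q hq]
    have hid : (z p - z q) * (z p + z q) =
        -((x p - x q) * (x p + x q)) - (y p - y q) * (y p + y q) := by
      linear_combination hsph p hp - hsph q hq
    have hxx : |x p + x q| ≤ 1 := (abs_add_le _ _).trans (by linarith [hxρ p hp, hxρ q hq])
    have hyy : |y p + y q| ≤ 1 := (abs_add_le _ _).trans (by linarith [hyρ p hp, hyρ q hq])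
    have hzz : |z p - z q| ≤ 2 * (γ / 10) := by
      calc |z p - z q| ≤ |z p - z q| * (z p + z q) := le_mul_of_one_le_right (abs_nonneg _) hsum
        _ = |(z p - z q) * (z p + z q)| := by rw [abs_mul, abs_of_pos (by linarith : 0 < z p + z q)]
        _ ≤ |x p - x q| * |x p + x q| + |y p - y q| * |y p + y q| := by
            rw [hid]
            refine (abs_sub _ _).trans ?_
            rw [abs_neg, abs_mul, abs_mul]
        _ ≤ γ / 10 * 1 + γ / 10 * 1 := by gcongr
        _ = _ := by ring
    have k1 := sq_le_sq' (abs_le.1 hzz).1 (abs_le.1 hzz).2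
    have k2 := sq_le_sq' (abs_le.1 h1.le).1 (abs_le.1 h1.le).2
    have k3 := sq_le_sq' (abs_le.1 h2.le).1 (abs_le.1 h2.le).2
    nlinarith [pow_pos hγ 2]

/-- Separated points of the unit sphere, in coordinates, contained in a set of size `γ'` and in a
slab of thickness `h` orthogonal to the `z`-axis. -/
theorem card_le_of_separated_in_slab {α : Type*} (T : Finset α) (x y z : α → ℝ) {γ γ' h : ℝ}
    (hγ : 0 < γ) (hγγ' : γ < γ') (hγ1 : γ ≤ 1) (hh : 0 ≤ h)
    (hsph : ∀ p ∈ T, x p ^ 2 + y p ^ 2 + z p ^ 2 = 1)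
    (hsep : ∀ p ∈ T, ∀ q ∈ T, p ≠ q →
      2 / 5 * γ ^ 2 ≤ (x p - x q) ^ 2 + (y p - y q) ^ 2 + (z p - z q) ^ 2)
    (hx : ∀ p ∈ T, ∀ q ∈ T, |x p - x q| ≤ 2 * γ')
    (hy : ∀ p ∈ T, ∀ q ∈ T, |y p - y q| ≤ 2 * γ')
    (hz : ∀ p ∈ T, ∀ q ∈ T, |z p - z q| ≤ h) :
    (T.card : ℝ) ≤ 1600 * (γ' / γ + h / γ ^ 2) := by
  classical
  rcases T.eq_empty_or_nonempty with rfl | hne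
  · have : 0 < γ' := hγ.trans hγγ'
    simp only [Finset.card_empty, Nat.cast_zero]
    positivity
  obtain ⟨m, hm, hmax⟩ := T.exists_max_image (fun p => x p ^ 2 + y p ^ 2) hne
  set ρ := max γ (√(x m ^ 2 + y m ^ 2)) with hρdef
  have hm0 : 0 ≤ x m ^ 2 + y m ^ 2 := by positivity
  have hγρ : γ ≤ ρ := le_max_left _ _
  have hρ : ρ ≤ 1 := max_le hγ1 (Real.sqrt_le_one.2 (by nlinarith [hsph m hm, sq_nonneg (z m)]))
  have hle : ∀ p ∈ T, x p ^ 2 + y p ^ 2 ≤ ρ ^ 2 := fun p hp =>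
    (hmax p hp).trans ((Real.sqrt_le_left (hγ.le.trans hγρ)).1 (le_max_right _ _))
  have hpolar : ∀ p ∈ T, x p ^ 2 + y p ^ 2 < ρ ^ 2 / 4 → ρ ^ 2 ≤ γ ^ 2 + 3 * h := by
    intro p hp hlt
    rcases le_total γ (√(x m ^ 2 + y m ^ 2)) with hc | hc
    · have e : ρ ^ 2 = x m ^ 2 + y m ^ 2 := by rw [hρdef, max_eq_right hc, Real.sq_sqrt hm0]
      have hzp : |z p| ≤ 1 := abs_le_of_sq_le_sq
        (by nlinarith [hsph p hp, sq_nonneg (x p), sq_nonneg (y p)]) zero_le_one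
      have hzm : |z m| ≤ 1 := abs_le_of_sq_le_sq
        (by nlinarith [hsph m hm, sq_nonneg (x m), sq_nonneg (y m)]) zero_le_one
      have h1 : (z p - z m) * (z p + z m) ≤ h * 2 := by
        refine (le_abs_self _).trans ?_
        rw [abs_mul]
        gcongr
        · exact hz p hp m hm
        · exact (abs_add_le _ _).trans (by linarith)
      nlinarith [hsph p hp, hsph m hm, pow_pos hγ 2]
    · rw [hρdef, max_eq_left hc]
      linarith
  have b4 : 1 ≤ γ' / γ := by rw [one_le_div hγ]; exact hγγ'.le
  have hH : 0 ≤ h / γ ^ 2 := by positivity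
  have side : ∀ u v : α → ℝ, (∀ p, u p ^ 2 + v p ^ 2 = x p ^ 2 + y p ^ 2) →
      (∀ p q, (u p - u q) ^ 2 + (v p - v q) ^ 2 = (x p - x q) ^ 2 + (y p - y q) ^ 2) →
      (∀ p ∈ T, ∀ q ∈ T, |v p - v q| ≤ 2 * γ') →
      ((T.filter fun p => ρ ^ 2 / 4 ≤ x p ^ 2 + y p ^ 2 ∧ |v p| ≤ u p).card : ℝ) ≤
        21 * (γ' / γ) + 210 * (h / γ ^ 2) := by
    intro u v huv hd hv
    refine card_le_of_side_region _ u v z hγ hγγ' hh hγρ hρ ?_ ?_ ?_ ?_ ?_ ?_ ?_ <;>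
      simp only [Finset.mem_filter, huv, hd]
    · exact fun p hp => hsph p hp.1
    · exact fun p hp q hq => hsep p hp.1 q hq.1
    · exact fun p hp q hq => hv p hp.1 q hq.1
    · exact fun p hp q hq => hz p hp.1 q hq.1
    · exact fun p hp => hle p hp.1
    · exact fun p hp => hp.2.1
    · exact fun p hp => hp.2.2
  have polar : ∀ w : α → ℝ, (∀ p, w p ^ 2 = z p ^ 2) →
      (∀ p q, (w p - w q) ^ 2 = (z p - z q) ^ 2) →
      ((T.filter fun p => x p ^ 2 + y p ^ 2 < ρ ^ 2 / 4 ∧ 0 ≤ w p).card : ℝ) ≤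
        121 * (γ' / γ) + 363 * (h / γ ^ 2) := by
    intro w hw hd
    rcases (T.filter fun p => x p ^ 2 + y p ^ 2 < ρ ^ 2 / 4 ∧ 0 ≤ w p).eq_empty_or_nonempty
      with he | ⟨p, hp⟩
    · rw [he, Finset.card_empty, Nat.cast_zero]
      linarith
    rw [Finset.mem_filter] at hp
    have hρ2 : ρ ^ 2 / γ ^ 2 ≤ 1 + 3 * (h / γ ^ 2) := by
      rw [div_le_iff₀ (by positivity), add_mul, mul_assoc, div_mul_cancel₀ _ (by positivity),
        one_mul]
      exact hpolar p hp.1 hp.2.1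
    have hcard := card_le_of_polar_region
      (T.filter fun p => x p ^ 2 + y p ^ 2 < ρ ^ 2 / 4 ∧ 0 ≤ w p) x y w hγ hγρ hρ
      (fun p hp => by rw [hw]; exact hsph p (Finset.mem_filter.1 hp).1)
      (fun p hp q hq => by
        rw [hd]; exact hsep p (Finset.mem_filter.1 hp).1 q (Finset.mem_filter.1 hq).1)
      (fun p hp => (Finset.mem_filter.1 hp).2.1) (fun p hp => (Finset.mem_filter.1 hp).2.2)
    linarith
  have hneg : ∀ f : α → ℝ, (∀ p ∈ T, ∀ q ∈ T, |f p - f q| ≤ 2 * γ') →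
      ∀ p ∈ T, ∀ q ∈ T, |-f p - -f q| ≤ 2 * γ' := by
    intro f hf p hp q hq
    rw [neg_sub_neg]
    exact hf q hq p hp
  have s1 := side x y (fun p => rfl) (fun p q => rfl) hy
  have s2 := side (fun p => -x p) (fun p => -y p) (fun p => by ring) (fun p q => by ring)
    (hneg y hy)
  have s3 := side y x (fun p => by ring) (fun p q => by ring) hx
  have s4 := side (fun p => -y p) (fun p => -x p) (fun p => by ring) (fun p q => by ring)
    (hneg x hx)
  have p1 := polar z (fun p => rfl) (fun p q => rfl)
  have p2 := polar (fun p => -z p) (fun p => by ring) (fun p q => by ring)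
  have hcover : T ⊆
      (T.filter fun p => ρ ^ 2 / 4 ≤ x p ^ 2 + y p ^ 2 ∧ |y p| ≤ x p) ∪
      (T.filter fun p => ρ ^ 2 / 4 ≤ x p ^ 2 + y p ^ 2 ∧ |-y p| ≤ -x p) ∪
      (T.filter fun p => ρ ^ 2 / 4 ≤ x p ^ 2 + y p ^ 2 ∧ |x p| ≤ y p) ∪
      (T.filter fun p => ρ ^ 2 / 4 ≤ x p ^ 2 + y p ^ 2 ∧ |-x p| ≤ -y p) ∪
      (T.filter fun p => x p ^ 2 + y p ^ 2 < ρ ^ 2 / 4 ∧ 0 ≤ z p) ∪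
      (T.filter fun p => x p ^ 2 + y p ^ 2 < ρ ^ 2 / 4 ∧ 0 ≤ -z p) := by
    intro p hp
    simp only [Finset.mem_union, Finset.mem_filter, hp, true_and, abs_neg]
    rcases lt_or_ge (x p ^ 2 + y p ^ 2) (ρ ^ 2 / 4) with hc | hc
    · rcases le_total 0 (z p) with h0 | h0
      · exact Or.inl (Or.inr ⟨hc, h0⟩)
      · exact Or.inr ⟨hc, by linarith⟩
    · left; left
      rcases le_total |y p| |x p| with h1 | h1
      · left; left
        rcases abs_choice (x p) with h2 | h2 <;> rw [h2] at h1
        · exact Or.inl ⟨hc, h1⟩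
        · exact Or.inr ⟨hc, h1⟩
      · rcases abs_choice (y p) with h2 | h2 <;> rw [h2] at h1
        · exact Or.inl (Or.inr ⟨hc, h1⟩)
        · exact Or.inr ⟨hc, h1⟩
  have hcard := Finset.card_le_card hcover
  have hcard' : (T.card : ℝ) ≤ _ := Nat.cast_le.2 (hcard.trans
    ((Finset.card_union_le _ _).trans (Nat.add_le_add_right
    ((Finset.card_union_le _ _).trans (Nat.add_le_add_right
    ((Finset.card_union_le _ _).trans (Nat.add_le_add_right
    ((Finset.card_union_le _ _).trans (Nat.add_le_add_right
    (Finset.card_union_le _ _) _)) _)) _)) _)))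
  push_cast at hcard'
  linarith

/-- For unit vectors, the squared distance in terms of the angle. -/
theorem norm_sub_sq_eq_of_norm_eq_one {V : Type*} [NormedAddCommGroup V] [InnerProductSpace ℝ V]
    {a b : V} (ha : ‖a‖ = 1) (hb : ‖b‖ = 1) :
    ‖a - b‖ ^ 2 = 2 - 2 * Real.cos (InnerProductGeometry.angle a b) := by
  rw [norm_sub_sq_real, InnerProductGeometry.cos_angle, ha, hb]
  ring

/-- The chord between two unit vectors is at most their angle. -/
theorem norm_sub_le_angle_of_norm_eq_one {V : Type*} [NormedAddCommGroup V]
    [InnerProductSpace ℝ V] {a b : V} (ha : ‖a‖ = 1) (hb : ‖b‖ = 1) :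
    ‖a - b‖ ≤ InnerProductGeometry.angle a b := by
  refine le_of_sq_le_sq ?_ (InnerProductGeometry.angle_nonneg a b)
  rw [norm_sub_sq_eq_of_norm_eq_one ha hb]
  linarith [Real.one_sub_sq_div_two_le_cos (x := InnerProductGeometry.angle a b)]

/-- The chord between two unit vectors is bounded below by a multiple of their angle. -/
theorem mul_angle_sq_le_norm_sub_sq_of_norm_eq_one {V : Type*} [NormedAddCommGroup V]
    [InnerProductSpace ℝ V] {a b : V} (ha : ‖a‖ = 1) (hb : ‖b‖ = 1) :
    2 / 5 * InnerProductGeometry.angle a b ^ 2 ≤ ‖a - b‖ ^ 2 := by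
  have hpi : (1 : ℝ) / 5 ≤ 2 / Real.pi ^ 2 := by
    rw [div_le_div_iff₀ (by norm_num) (by positivity)]
    nlinarith [Real.pi_lt_d2, Real.pi_pos]
  have hcos := Real.cos_le_one_sub_mul_cos_sq (x := InnerProductGeometry.angle a b)
    (by rw [abs_of_nonneg (InnerProductGeometry.angle_nonneg a b)]
        exact InnerProductGeometry.angle_le_pi a b)
  rw [norm_sub_sq_eq_of_norm_eq_one ha hb]
  nlinarith [mul_le_mul_of_nonneg_right hpi (sq_nonneg (InnerProductGeometry.angle a b))]

/-- Every nonzero vector of `E3` is a multiple of the last vector of some orthonormal basis. -/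
theorem exists_orthonormalBasis_eq_normalize {ξ : E3} (hξ : ξ ≠ 0) :
    ∃ b : OrthonormalBasis (Fin 3) ℝ E3, b 2 = ‖ξ‖⁻¹ • ξ := by
  have hnorm : ‖‖ξ‖⁻¹ • ξ‖ = 1 := norm_smul_inv_norm (𝕜 := ℝ) hξ
  obtain ⟨b, hb⟩ := Orthonormal.exists_orthonormalBasis_extension_of_card_eq (𝕜 := ℝ) (E := E3)
    (ι := Fin 3) (by simp) (v := fun _ => ‖ξ‖⁻¹ • ξ) (s := {2}) (by
      constructor
      · simpa [Set.domRestrict] using hnorm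
      · intro i j hij
        exact (hij (Subsingleton.elim i j)).elim)
  exact ⟨b, hb 2 rfl⟩

/-- Partial orthogonality of thickened null hyperplanes associated to a
γ-separated set of directions (Lemma L:Lemma). -/
theorem separated_directions_null_hyperplane_count :
    ∃ C > (0 : ℝ),
      ∀ (N d : ℝ), 0 < N → 0 < d →
      ∀ (ω₀ : E3), ‖ω₀‖ = 1 →
      ∀ (γ γ' : ℝ), 0 < γ → γ < γ' → γ' < 1 →
      ∀ (Ω : Set E3), (∀ ω ∈ Ω, ‖ω‖ = 1) →
        (∀ ω ∈ Ω, ∀ ω' ∈ Ω, ω ≠ ω' → γ ≤ InnerProductGeometry.angle ω ω') →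
      ∀ (τ : ℝ) (ξ : E3), N / 2 ≤ ‖ξ‖ → ‖ξ‖ ≤ 2 * N →
      ∀ (T : Finset E3),
        (↑T : Set E3) ⊆ {ω ∈ Ω | InnerProductGeometry.angle ω ω₀ ≤ γ'
            ∧ |(-τ) + ⟪ξ, ω⟫_ℝ| ≤ d} →
        (T.card : ℝ) ≤ C * (γ' / γ + d / (N * γ ^ 2)) := by
  refine ⟨6400, by norm_num, ?_⟩
  intro N d hN hd ω₀ hω₀ γ γ' hγ hγγ' hγ'1 Ω hΩ hsep τ ξ hξ1 _ T hT
  have hξ0 : 0 < ‖ξ‖ := by linarith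
  obtain ⟨b, hb⟩ := exists_orthonormalBasis_eq_normalize (norm_pos_iff.1 hξ0)
  have hpyth : ∀ v : E3, ⟪b 0, v⟫_ℝ ^ 2 + ⟪b 1, v⟫_ℝ ^ 2 + ⟪b 2, v⟫_ℝ ^ 2 = ‖v‖ ^ 2 := by
    intro v
    have h := b.sum_sq_norm_inner_right v
    simpa [Fin.sum_univ_three] using h
  have hdist : ∀ p ∈ T, ∀ q ∈ T, ‖p - q‖ ≤ 2 * γ' := by
    intro p hp q hq
    have h1 := norm_sub_le_angle_of_norm_eq_one (hΩ p (hT hp).1) hω₀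
    have h2 := norm_sub_le_angle_of_norm_eq_one (hΩ q (hT hq).1) hω₀
    have h3 := norm_sub_le_norm_sub_add_norm_sub p ω₀ q
    rw [norm_sub_rev ω₀ q] at h3
    linarith [(hT hp).2.1, (hT hq).2.1]
  have hcoord : ∀ i, ∀ p ∈ T, ∀ q ∈ T, |⟪b i, p⟫_ℝ - ⟪b i, q⟫_ℝ| ≤ 2 * γ' := by
    intro i p hp q hq
    rw [← inner_sub_right]
    refine (abs_real_inner_le_norm _ _).trans ?_
    rw [b.norm_eq_one, one_mul]
    exact hdist p hp q hq
  have hcard := card_le_of_separated_in_slab T (fun v => ⟪b 0, v⟫_ℝ) (fun v => ⟪b 1, v⟫_ℝ)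
    (fun v => ⟪b 2, v⟫_ℝ) (h := 4 * (d / N)) hγ hγγ' (by linarith) (by positivity)
    (fun p hp => by rw [hpyth, hΩ p (hT hp).1, one_pow]) ?_ (hcoord 0) (hcoord 1) ?_
  · have e : 4 * (d / N) / γ ^ 2 = 4 * (d / (N * γ ^ 2)) := by field_simp
    have : 0 < γ' / γ := div_pos (hγ.trans hγγ') hγ
    rw [e] at hcard
    linarith
  · intro p hp q hq hne
    simp only [← inner_sub_right]
    rw [hpyth]
    refine le_trans ?_
      (mul_angle_sq_le_norm_sub_sq_of_norm_eq_one (hΩ p (hT hp).1) (hΩ q (hT hq).1))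
    have := hsep p (hT hp).1 q (hT hq).1 hne
    gcongr
  · intro p hp q hq
    simp only [hb, real_inner_smul_left]
    rw [← mul_sub, abs_mul, abs_of_pos (inv_pos.2 hξ0), inv_mul_le_iff₀ hξ0]
    have h1 := abs_le.1 (hT hp).2.2
    have h2 := abs_le.1 (hT hq).2.2
    have h3 : 2 * d ≤ ‖ξ‖ * (4 * (d / N)) := by
      calc 2 * d = N / 2 * (4 * (d / N)) := by field_simp; ring
        _ ≤ _ := by gcongr
    rw [abs_le]
    constructor <;> linarith
end
end

section
/- There is a universal constant C > 0 with the following property. Let N, L > 0 and a sign s ∈ {+1, −1}, and let u : ℝ × ℝ³ → ℂ be a Schwartz function whose space–time Fourier transform û(τ, ξ) is supported in K^s_{N,L} = {(τ, ξ) : N/2 < |ξ| ≤ N and |−τ + s·|ξ|| ≤ L}. Then ‖u‖_{L⁴(ℝ × ℝ³)} ≤ C (N L)^{1/2} ‖u‖_{L²(ℝ × ℝ³)}. -/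
open MeasureTheory Set
open scoped ENNReal InnerProductSpace

noncomputable section

abbrev Spacetime : Type := ℝ × E3

/-- Thickened truncated null cone `K^s_{N,L}`. -/
def cone (s N L : ℝ) : Set Spacetime :=
  {X | N / 2 < ‖X.2‖ ∧ ‖X.2‖ ≤ N ∧ |(-X.1) + s * ‖X.2‖| ≤ L}

/-- Space–time Fourier transform `û(τ,ξ) = ∫ e^{−i(tτ + x·ξ)} u(t,x) dt dx`. -/
def spacetimeFT (u : Spacetime → ℂ) (Z : Spacetime) : ℂ :=
  ∫ X : Spacetime, Complex.exp (-Complex.I * ((X.1 * Z.1 + ⟪X.2, Z.2⟫_ℝ : ℝ) : ℂ)) * u X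

open scoped FourierTransform SchwartzMap

/-- Cauchy–Schwarz for a function supported in a given set. -/
theorem sq_lintegral_le_of_support {α : Type*} [MeasurableSpace α] {μ : Measure α} {f : α → ℝ≥0∞}
    (hf : AEMeasurable f μ) {T : Set α} (hT : MeasurableSet T) (h : Function.support f ⊆ T) :
    (∫⁻ x, f x ∂μ) ^ 2 ≤ μ T * ∫⁻ x, f x ^ 2 ∂μ := by
  have h1 : ∫⁻ x, f x ∂μ = ∫⁻ x, ((T.indicator 1 : α → ℝ≥0∞) * f) x ∂μ := by
    congr 1 with x
    by_cases hx : x ∈ T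
    · simp [hx]
    · simp [hx, Function.notMem_support.1 fun h' => hx (h h')]
  have h2 := ENNReal.lintegral_mul_le_Lp_mul_Lq μ Real.HolderConjugate.two_two
    (f := T.indicator 1) (g := f) ((measurable_const.indicator hT).aemeasurable) hf
  have h3 : ∫⁻ x, (T.indicator 1 x : ℝ≥0∞) ^ (2 : ℝ) ∂μ = μ T := by
    rw [← lintegral_indicator_one hT]
    congr 1 with x
    by_cases hx : x ∈ T <;> simp [hx]
  rw [h3, ← ENNReal.mul_rpow_of_nonneg _ _ (by norm_num)] at h2
  rw [h1, ← ENNReal.rpow_two]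
  calc _ ≤ ((μ T * ∫⁻ x, f x ^ (2 : ℝ) ∂μ) ^ (1 / 2 : ℝ)) ^ (2 : ℝ) := by gcongr
    _ = _ := by rw [← ENNReal.rpow_mul]; simp

section
variable {E : Type*} [NormedAddCommGroup E] [InnerProductSpace ℝ E] [FiniteDimensional ℝ E]
  [MeasurableSpace E] [BorelSpace E]

/-- Plancherel's theorem for Schwartz functions, in terms of `eLpNorm`. -/
theorem eLpNorm_fourier_two (f : 𝓢(E, ℂ)) :
    eLpNorm (𝓕 f : 𝓢(E, ℂ)) 2 volume = eLpNorm f 2 volume := by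
  have h1 := ((𝓕 f : 𝓢(E, ℂ)).memLp 2 (volume : Measure E)).eLpNorm_ne_top
  have h2 := (f.memLp 2 (volume : Measure E)).eLpNorm_ne_top
  rw [← ENNReal.toReal_eq_toReal_iff' h1 h2, ← SchwartzMap.norm_toLp, ← SchwartzMap.norm_toLp]
  exact SchwartzMap.norm_fourier_toL2_eq f

/-- If the Fourier support `S` of `U` is such that all intersections `S ∩ (x - S)` have measure at
most `M`, then `‖U‖₄ ≤ M ^ (1 / 4) ‖U‖₂`. -/
theorem eLpNorm_four_le_of_fourierInv_support (U : 𝓢(E, ℂ)) {S : Set E} (hS : MeasurableSet S)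
    (hU : Function.support (𝓕⁻ U : 𝓢(E, ℂ)) ⊆ S) {M : ℝ≥0∞}
    (hM : ∀ x, volume {y | y ∈ S ∧ x - y ∈ S} ≤ M) :
    eLpNorm U 4 volume ^ 4 ≤ M * eLpNorm U 2 volume ^ 4 := by
  set V : 𝓢(E, ℂ) := 𝓕⁻ U with hV
  have hFV : 𝓕 V = U := by simp [hV]
  have h4 : eLpNorm U 4 volume ^ 4 = ∫⁻ x, ‖U x‖ₑ ^ 4 := by
    have := eLpNorm_nnreal_pow_eq_lintegral (f := U) (μ := volume) (p := 4) (by norm_num)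
    simpa [ENNReal.rpow_ofNat] using this
  have h2 (f : 𝓢(E, ℂ)) : eLpNorm f 2 volume ^ 2 = ∫⁻ x, ‖f x‖ₑ ^ 2 := by
    have := eLpNorm_nnreal_pow_eq_lintegral (f := f) (μ := volume) (p := 2) (by norm_num)
    simpa [ENNReal.rpow_ofNat] using this
  set B := ContinuousLinearMap.mul ℂ ℂ
  set W := SchwartzMap.convolution B V V with hW
  have hFW : 𝓕 W = SchwartzMap.pairing B U U := by
    rw [hW, SchwartzMap.fourier_convolution, hFV]
  have hsq : ∫⁻ x, ‖U x‖ₑ ^ 4 = ∫⁻ x, ‖W x‖ₑ ^ 2 := by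
    rw [← h2 W, ← eLpNorm_fourier_two, h2, hFW]
    congr 1 with x
    rw [SchwartzMap.pairing_apply_apply]
    simp only [B, ContinuousLinearMap.mul_apply', enorm_mul]
    ring
  have hVU : eLpNorm V 2 volume = eLpNorm U 2 volume := by rw [← hFV, eLpNorm_fourier_two]
  have hVm : Measurable fun y => ‖V y‖ₑ := V.continuous.measurable.enorm
  have hpt (x : E) : ‖W x‖ₑ ^ 2 ≤ M * ∫⁻ y, ‖V y‖ₑ ^ 2 * ‖V (x - y)‖ₑ ^ 2 := by
    have h5 : ‖W x‖ₑ ≤ ∫⁻ y, ‖V y‖ₑ * ‖V (x - y)‖ₑ := by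
      rw [hW, SchwartzMap.convolution_apply]
      refine (enorm_integral_le_lintegral_enorm _).trans_eq ?_
      simp [B]
    calc ‖W x‖ₑ ^ 2 ≤ (∫⁻ y, ‖V y‖ₑ * ‖V (x - y)‖ₑ) ^ 2 := by gcongr
      _ ≤ volume {y | y ∈ S ∧ x - y ∈ S} * ∫⁻ y, (‖V y‖ₑ * ‖V (x - y)‖ₑ) ^ 2 := by
        apply sq_lintegral_le_of_support
        · exact (hVm.mul (hVm.comp (measurable_const.sub measurable_id))).aemeasurable
        · exact hS.inter ((measurable_const.sub measurable_id) hS)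
        · intro y hy
          simp only [Function.mem_support, ne_eq, mul_eq_zero, enorm_eq_zero, not_or] at hy
          exact ⟨hU hy.1, hU hy.2⟩
      _ ≤ _ := by
        simp only [mul_pow]
        gcongr
        exact hM x
  rw [h4, hsq, ← hVU]
  have hm : Measurable fun p : E × E => ‖V p.2‖ₑ ^ 2 * ‖V (p.1 - p.2)‖ₑ ^ 2 :=
    ((hVm.comp measurable_snd).pow_const 2).mul
      ((hVm.comp (measurable_fst.sub measurable_snd)).pow_const 2)
  calc ∫⁻ x, ‖W x‖ₑ ^ 2 ≤ ∫⁻ x, M * ∫⁻ y, ‖V y‖ₑ ^ 2 * ‖V (x - y)‖ₑ ^ 2 := lintegral_mono hpt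
    _ = M * ∫⁻ x, ∫⁻ y, ‖V y‖ₑ ^ 2 * ‖V (x - y)‖ₑ ^ 2 :=
      lintegral_const_mul _ hm.lintegral_prod_right'
    _ = M * ∫⁻ y, ∫⁻ x, ‖V y‖ₑ ^ 2 * ‖V (x - y)‖ₑ ^ 2 := by
      rw [lintegral_lintegral_swap hm.aemeasurable]
    _ = M * ∫⁻ y, ‖V y‖ₑ ^ 2 * ∫⁻ x, ‖V x‖ₑ ^ 2 := by
      congr 2 with y
      have hmy : Measurable fun x => ‖V (x - y)‖ₑ ^ 2 :=
        (hVm.comp (measurable_id.sub measurable_const)).pow_const 2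
      rw [lintegral_const_mul _ hmy, lintegral_sub_right_eq_self (fun x => ‖V x‖ₑ ^ 2) y]
    _ = M * ((∫⁻ y, ‖V y‖ₑ ^ 2) * ∫⁻ x, ‖V x‖ₑ ^ 2) := by
      rw [lintegral_mul_const _ (hVm.pow_const 2)]
    _ = M * eLpNorm V 2 volume ^ 4 := by rw [← h2]; ring
end

/-- A planar set on which `‖b‖ ^ 2` oscillates by at most `D` has area at most `π D`. -/
theorem volume_le_of_sq_norm_sub_le {V : Type*} [NormedAddCommGroup V] [InnerProductSpace ℝ V]
    [FiniteDimensional ℝ V] [MeasurableSpace V] [BorelSpace V] (hV : Module.finrank ℝ V = 2)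
    {T : Set V} {D : ℝ} (h : ∀ b ∈ T, ∀ b' ∈ T, ‖b‖ ^ 2 - ‖b'‖ ^ 2 ≤ D) :
    volume T ≤ ENNReal.ofReal (Real.pi * D) := by
  have : Nontrivial V := Module.nontrivial_of_finrank_pos (R := ℝ) (by omega)
  obtain rfl | ⟨b₀, hb₀⟩ := T.eq_empty_or_nonempty
  · simp
  have hD : 0 ≤ D := by simpa using h b₀ hb₀ b₀ hb₀
  set w := sInf ((fun b => ‖b‖ ^ 2) '' T)
  have hw : 0 ≤ w := Real.sInf_nonneg (by rintro _ ⟨b, -, rfl⟩; positivity)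
  have hle : ∀ b ∈ T, w ≤ ‖b‖ ^ 2 := fun b hb =>
    csInf_le ⟨0, by rintro _ ⟨b, -, rfl⟩; positivity⟩ ⟨b, hb, rfl⟩
  have hge : ∀ b ∈ T, ‖b‖ ^ 2 - D ≤ w := fun b hb =>
    le_csInf ⟨_, b₀, hb₀, rfl⟩ (by rintro _ ⟨b', hb', rfl⟩; linarith [h b hb b' hb'])
  have hsub : T ⊆ Metric.closedBall 0 √(w + D) \ Metric.ball 0 √w := fun b hb => by
    simp only [mem_sdiff, mem_closedBall_zero_iff, mem_ball_zero_iff, not_lt]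
    exact ⟨Real.le_sqrt_of_sq_le (by linarith [hge b hb]),
      Real.sqrt_le_iff.2 ⟨norm_nonneg _, hle b hb⟩⟩
  refine (measure_mono hsub).trans ?_
  rw [measure_sdiff (Metric.ball_subset_closedBall.trans (Metric.closedBall_subset_closedBall
      (Real.sqrt_le_sqrt (by linarith)))) measurableSet_ball.nullMeasurableSet
      measure_ball_lt_top.ne, InnerProductSpace.volume_closedBall, InnerProductSpace.volume_ball,
    hV, ← ENNReal.ofReal_pow (Real.sqrt_nonneg _), ← ENNReal.ofReal_pow (Real.sqrt_nonneg _),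
    Real.sq_sqrt hw, Real.sq_sqrt (by positivity), Real.sq_sqrt (by positivity),
    ← ENNReal.ofReal_mul (by positivity), ← ENNReal.ofReal_mul hw,
    ← ENNReal.ofReal_sub _ (by norm_num; positivity)]
  apply ENNReal.ofReal_le_ofReal
  norm_num
  nlinarith

/-- Volume of a thickened ellipsoid with foci `0` and `(k, 0)`, in an orthogonal splitting. -/
theorem volume_ellipsoidal_shell_prod_le {K V : Type*}
    [NormedAddCommGroup K] [InnerProductSpace ℝ K]
    [FiniteDimensional ℝ K] [MeasurableSpace K] [BorelSpace K] (hK : Module.finrank ℝ K = 1)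
    [NormedAddCommGroup V] [InnerProductSpace ℝ V]
    [FiniteDimensional ℝ V] [MeasurableSpace V] [BorelSpace V] (hV : Module.finrank ℝ V = 2)
    (k : K) (a N δ : ℝ) (hN : 0 ≤ N) (hδ : 0 ≤ δ) :
    volume {p : WithLp 2 (K × V) | ‖p‖ ≤ N ∧
      |a + ‖p‖ + ‖WithLp.toLp 2 (k, (0 : V)) - p‖| ≤ δ} ≤
      ENNReal.ofReal (8 * Real.pi * N ^ 2 * δ) := by
  have : Nontrivial K := Module.nontrivial_of_finrank_pos (R := ℝ) (by omega)
  set A := {p : WithLp 2 (K × V) | ‖p‖ ≤ N ∧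
      |a + ‖p‖ + ‖WithLp.toLp 2 (k, (0 : V)) - p‖| ≤ δ} with hA
  have hAm : MeasurableSet A := by
    rw [hA, ofPred_and]
    exact (IsClosed.inter (isClosed_le (by fun_prop) (by fun_prop))
      (isClosed_le (by fun_prop) (by fun_prop))).measurableSet
  rw [← (WithLp.volume_preserving_toLp K V).measure_preimage hAm.nullMeasurableSet,
    Measure.volume_eq_prod, Measure.prod_apply (hAm.preimage (by fun_prop))]
  have hslice (x : K) : volume (Prod.mk x ⁻¹' (WithLp.toLp 2 ⁻¹' A)) ≤
      (Metric.closedBall 0 N).indicator (fun _ => ENNReal.ofReal (Real.pi * (4 * δ * N))) x := by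
    by_cases hx : x ∈ Metric.closedBall 0 N
    · rw [indicator_of_mem hx]
      apply volume_le_of_sq_norm_sub_le hV
      intro b hb b' hb'
      simp only [hA, mem_preimage, mem_ofPred_eq, WithLp.prod_norm_eq_of_L2, WithLp.sub_fst,
        WithLp.sub_snd, WithLp.toLp_fst, WithLp.toLp_snd, zero_sub, norm_neg] at hb hb'
      obtain ⟨h1, h2⟩ := hb
      obtain ⟨h1', h2'⟩ := hb'
      rcases le_total (‖b‖ ^ 2) (‖b'‖ ^ 2) with hle | hle
      · have : 0 ≤ δ * N := by positivity
        linarith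
      have hσ : √(‖k - x‖ ^ 2 + ‖b'‖ ^ 2) ≤ √(‖k - x‖ ^ 2 + ‖b‖ ^ 2) :=
        Real.sqrt_le_sqrt (by linarith)
      have hρ : √(‖x‖ ^ 2 + ‖b'‖ ^ 2) ≤ √(‖x‖ ^ 2 + ‖b‖ ^ 2) :=
        Real.sqrt_le_sqrt (by linarith)
      have hd : √(‖x‖ ^ 2 + ‖b‖ ^ 2) - √(‖x‖ ^ 2 + ‖b'‖ ^ 2) ≤ 2 * δ := by
        linarith [(abs_le.1 h2).2, (abs_le.1 h2').1]
      have e := Real.sq_sqrt (show 0 ≤ ‖x‖ ^ 2 + ‖b‖ ^ 2 by positivity)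
      have e' := Real.sq_sqrt (show 0 ≤ ‖x‖ ^ 2 + ‖b'‖ ^ 2 by positivity)
      have hs : √(‖x‖ ^ 2 + ‖b‖ ^ 2) + √(‖x‖ ^ 2 + ‖b'‖ ^ 2) ≤ 2 * N := by linarith
      calc ‖b‖ ^ 2 - ‖b'‖ ^ 2 = (√(‖x‖ ^ 2 + ‖b‖ ^ 2) - √(‖x‖ ^ 2 + ‖b'‖ ^ 2)) *
            (√(‖x‖ ^ 2 + ‖b‖ ^ 2) + √(‖x‖ ^ 2 + ‖b'‖ ^ 2)) := by linear_combination e' - e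
        _ ≤ (2 * δ) * (2 * N) := by gcongr
        _ = 4 * δ * N := by ring
    · rw [indicator_of_notMem hx, nonpos_iff_eq_zero]
      convert measure_empty (μ := (volume : Measure V))
      refine eq_empty_of_forall_notMem fun b hb => hx ?_
      have := hb.1
      rw [WithLp.prod_norm_eq_of_L2] at this
      rw [mem_closedBall_zero_iff]
      refine le_trans (Real.le_sqrt_of_sq_le ?_) this
      simp
  refine (lintegral_mono hslice).trans ?_
  rw [lintegral_indicator measurableSet_closedBall, lintegral_const,
    Measure.restrict_apply_univ, InnerProductSpace.volume_closedBall, hK,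
    ← ENNReal.ofReal_pow hN, ← ENNReal.ofReal_mul (by positivity),
    ← ENNReal.ofReal_mul (by positivity)]
  apply ENNReal.ofReal_le_ofReal
  have hG : Real.Gamma (((1 : ℕ) : ℝ) / 2 + 1) = √Real.pi / 2 := by
    rw [Real.Gamma_add_one (by norm_num)]
    push_cast
    rw [Real.Gamma_one_half_eq]; ring
  rw [hG]
  have : √Real.pi ≠ 0 := by positivity
  apply le_of_eq
  field_simp
  ring

/-- Volume of a thickened ellipsoid with foci `0` and `ζ`. -/
theorem volume_ellipsoidal_shell_le (ζ : E3) (a N δ : ℝ) (hN : 0 ≤ N) (hδ : 0 ≤ δ) :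
    volume {ξ : E3 | ‖ξ‖ ≤ N ∧ |a + ‖ξ‖ + ‖ζ - ξ‖| ≤ δ} ≤
      ENNReal.ofReal (8 * Real.pi * N ^ 2 * δ) := by
  obtain ⟨e, he, hζ⟩ : ∃ e : E3, e ≠ 0 ∧ ζ ∈ Submodule.span ℝ {e} := by
    by_cases h : ζ = 0
    · obtain ⟨e, he⟩ := exists_ne (0 : E3)
      exact ⟨e, he, by simp [h]⟩
    · exact ⟨ζ, h, Submodule.mem_span_singleton_self ζ⟩
  set K := Submodule.span ℝ {e}
  have hK : Module.finrank ℝ K = 1 := finrank_span_singleton he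
  have hK' : Module.finrank ℝ Kᗮ = 2 := by
    have := K.finrank_add_finrank_orthogonal
    rw [hK, finrank_euclideanSpace_fin] at this
    omega
  have key := volume_ellipsoidal_shell_prod_le hK hK' ⟨ζ, hζ⟩ a N δ hN hδ
  refine le_of_eq_of_le ?_ key
  rw [← K.orthogonalDecomposition.measurePreserving.measure_preimage_equiv
    (f := K.orthogonalDecomposition.toMeasurableEquiv)]
  congr 1
  ext ξ
  have h0 : WithLp.toLp 2 ((⟨ζ, hζ⟩ : K), (0 : Kᗮ)) = K.orthogonalDecomposition ζ := by
    rw [Submodule.orthogonalDecomposition_apply,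
      Submodule.orthogonalProjectionOnto_mem_subspace_eq_self (⟨ζ, hζ⟩ : K),
      Submodule.orthogonalProjectionOnto_orthogonal_apply_eq_zero hζ]
  simp only [mem_preimage, mem_ofPred_eq, h0, LinearIsometryEquiv.coe_toMeasurableEquiv,
    ← map_sub, LinearIsometryEquiv.norm_map]

/-- The thickened truncated null cone without lower cut-off, reflected in time, as a subset of the
Euclidean space `WithLp 2 (ℝ × E3)`. -/
def fullCone (s N L : ℝ) : Set (WithLp 2 (ℝ × E3)) :=
  {p | ‖p.snd‖ ≤ N ∧ |p.fst + s * ‖p.snd‖| ≤ L}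

theorem measurableSet_fullCone (s N L : ℝ) : MeasurableSet (fullCone s N L) := by
  rw [fullCone, ofPred_and]
  exact ((isClosed_le (by fun_prop) (by fun_prop)).inter
    (isClosed_le (by fun_prop) (by fun_prop))).measurableSet

theorem volume_fullCone_inter_le {s N L : ℝ} (hs : s = 1 ∨ s = -1) (hN : 0 ≤ N) (hL : 0 ≤ L)
    (x : WithLp 2 (ℝ × E3)) :
    volume {y | y ∈ fullCone s N L ∧ x - y ∈ fullCone s N L} ≤
      ENNReal.ofReal (32 * Real.pi * N ^ 2 * L ^ 2) := by
  set A := {y | y ∈ fullCone s N L ∧ x - y ∈ fullCone s N L} with hA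
  have hAm : MeasurableSet A := by
    rw [hA, ofPred_and]
    exact (measurableSet_fullCone s N L).inter
      ((measurable_const.sub measurable_id) (measurableSet_fullCone s N L))
  set B := {ξ : E3 | ‖ξ‖ ≤ N ∧ |s * x.fst + ‖ξ‖ + ‖x.snd - ξ‖| ≤ 2 * L} with hB
  have hBm : MeasurableSet B := by
    rw [hB, ofPred_and]
    exact ((isClosed_le (by fun_prop) (by fun_prop)).inter
      (isClosed_le (by fun_prop) (by fun_prop))).measurableSet
  rw [← (WithLp.volume_preserving_toLp ℝ E3).measure_preimage hAm.nullMeasurableSet,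
    Measure.volume_eq_prod, Measure.prod_apply_symm (hAm.preimage (by fun_prop))]
  have hslice (ξ : E3) : volume ((fun t => (t, ξ)) ⁻¹' (WithLp.toLp 2 ⁻¹' A)) ≤
      B.indicator (fun _ => ENNReal.ofReal (2 * L)) ξ := by
    by_cases hξ : ξ ∈ B
    · rw [indicator_of_mem hξ]
      calc _ ≤ volume (Icc (-(s * ‖ξ‖) - L) (-(s * ‖ξ‖) + L)) := by
            refine measure_mono fun t ht => ?_
            have := abs_le.1 ht.1.2
            simp only [WithLp.toLp_fst, WithLp.toLp_snd] at this
            constructor <;> linarith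
        _ = _ := by rw [Real.volume_Icc]; ring_nf
    · rw [indicator_of_notMem hξ, nonpos_iff_eq_zero]
      convert measure_empty (μ := (volume : Measure ℝ))
      refine eq_empty_of_forall_notMem fun t ht => hξ ⟨ht.1.1, ?_⟩
      have h1 := abs_le.1 ht.1.2
      have h2 := abs_le.1 ht.2.2
      simp only [WithLp.toLp_fst, WithLp.toLp_snd, WithLp.sub_fst, WithLp.sub_snd] at h1 h2
      rw [abs_le]
      rcases hs with rfl | rfl <;> constructor <;> linarith
  calc _ ≤ ∫⁻ ξ, B.indicator (fun _ => ENNReal.ofReal (2 * L)) ξ := lintegral_mono hslice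
    _ = ENNReal.ofReal (2 * L) * volume B := lintegral_indicator_const hBm _
    _ ≤ ENNReal.ofReal (2 * L) * ENNReal.ofReal (8 * Real.pi * N ^ 2 * (2 * L)) := by
      gcongr
      exact volume_ellipsoidal_shell_le _ _ _ _ hN (by positivity)
    _ = _ := by
      rw [← ENNReal.ofReal_mul (by positivity)]
      ring_nf

/-- Comparison of the two normalizations of the Fourier transform. -/
theorem fourierInv_eq_spacetimeFT (u : Spacetime → ℂ) (p : WithLp 2 (ℝ × E3)) :
    𝓕⁻ (fun q : WithLp 2 (ℝ × E3) => u q.ofLp) p =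
      spacetimeFT u (-(2 * Real.pi) • p.ofLp) := by
  rw [Real.fourierInv_eq', spacetimeFT,
    ← (WithLp.volume_preserving_ofLp ℝ E3).integral_comp
      (MeasurableEquiv.toLp 2 (ℝ × E3)).symm.measurableEmbedding]
  congr 1 with q
  rw [smul_eq_mul]
  congr 2
  simp [WithLp.prod_inner_apply, inner_smul_right]
  ring

/-- Frequency-localized Strichartz L⁴ estimate for the 3D wave equation
(estimate (A:58)). -/
theorem strichartz_L4_frequency_localized :
    ∃ C > (0 : ℝ),
      ∀ (N L : ℝ), 0 < N → 0 < L →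
      ∀ (s : ℝ), (s = 1 ∨ s = -1) →
      ∀ (u : SchwartzMap Spacetime ℂ),
        Function.support (spacetimeFT u) ⊆ cone s N L →
      eLpNorm (⇑u) 4 volume
        ≤ ENNReal.ofReal (C * Real.sqrt (N * L)) * eLpNorm (⇑u) 2 volume := by
  refine ⟨4, by norm_num, fun N L hN hL s hs u hu => ?_⟩
  set U : 𝓢(WithLp 2 (ℝ × E3), ℂ) := SchwartzMap.compCLMOfContinuousLinearEquiv ℂ
    (WithLp.prodContinuousLinearEquiv 2 ℝ ℝ E3) u
  have hUu : (U : WithLp 2 (ℝ × E3) → ℂ) = u ∘ WithLp.ofLp := rfl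
  have hnorm (p : ℝ≥0∞) : eLpNorm U p volume = eLpNorm u p volume := by
    rw [hUu]
    exact eLpNorm_comp_measurePreserving u.continuous.aestronglyMeasurable
      (WithLp.volume_preserving_ofLp ℝ E3)
  have hsupp : Function.support (𝓕⁻ U : 𝓢(WithLp 2 (ℝ × E3), ℂ)) ⊆ fullCone s N L := by
    intro p hp
    have h1 : (𝓕⁻ U : 𝓢(WithLp 2 (ℝ × E3), ℂ)) p = spacetimeFT u (-(2 * Real.pi) • p.ofLp) := by
      rw [SchwartzMap.fourierInv_coe]
      exact fourierInv_eq_spacetimeFT u p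
    rw [Function.mem_support, h1] at hp
    obtain ⟨-, h2, h3⟩ := hu hp
    have hpi : 1 ≤ 2 * Real.pi := by linarith [Real.pi_gt_three]
    have hpi' : 0 ≤ 2 * Real.pi := by linarith
    have h4 : ‖(-(2 * Real.pi) • p.ofLp).2‖ = 2 * Real.pi * ‖p.snd‖ := by
      rw [Prod.smul_snd, norm_smul, norm_neg, Real.norm_of_nonneg hpi']; rfl
    have h5 : (-(2 * Real.pi) • p.ofLp).1 = -(2 * Real.pi * p.fst) := by
      rw [Prod.smul_fst, smul_eq_mul, neg_mul]; rfl
    rw [h4] at h2 h3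
    have h6 : -(-(2 * Real.pi) • p.ofLp).1 + s * (2 * Real.pi * ‖p.snd‖) =
        2 * Real.pi * (p.fst + s * ‖p.snd‖) := by rw [h5]; ring
    rw [h6, abs_mul, abs_of_nonneg hpi'] at h3
    exact ⟨(le_mul_of_one_le_left (norm_nonneg _) hpi).trans h2,
      (le_mul_of_one_le_left (abs_nonneg _) hpi).trans h3⟩
  have key := eLpNorm_four_le_of_fourierInv_support U (measurableSet_fullCone s N L) hsupp
    (volume_fullCone_inter_le hs hN.le hL.le)
  rw [hnorm, hnorm] at key
  rw [← ENNReal.pow_le_pow_left_iff (n := 4) (by norm_num), mul_pow,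
    ← ENNReal.ofReal_pow (by positivity)]
  refine key.trans ?_
  gcongr
  have h7 : √(N * L) ^ 4 = (N * L) ^ 2 := by
    rw [show 4 = 2 * 2 from rfl, pow_mul, Real.sq_sqrt (by positivity)]
  rw [mul_pow, h7]
  have := Real.pi_lt_four
  calc 32 * Real.pi * N ^ 2 * L ^ 2 = 32 * Real.pi * (N * L) ^ 2 := by ring
    _ ≤ 4 ^ 4 * (N * L) ^ 2 := by gcongr; linarith
end
end

section
/- There exist universal constants c ∈ (0,1) and C > 0 with the following property. Let N, L > 0, let a sign s ∈ {+1, −1} be given, let B ⊂ ℝ³ be a ball of radius r with arbitrary center, where 0 < r ≤ c·N, and let u : ℝ × ℝ³ → ℂ be a Schwartz function whose space–time Fourier transform û(τ, ξ) is supported in K^s_{N,L} ∩ {(τ, ξ) : ξ ∈ B}. Then ‖u‖_{L⁴(ℝ × ℝ³)} ≤ C ((rN)^{1/2} L)^{1/2} ‖u‖_{L²(ℝ × ℝ³)}. -/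
open MeasureTheory Set
open scoped ENNReal InnerProductSpace

noncomputable section

/-- A planar set on which `‖·‖²` oscillates by at most `D` lies in an annulus of area `π D`. -/
theorem volume_le_of_norm_sq_sub_le {T : Set ℂ} {D : ℝ} (hD : 0 ≤ D)
    (hT : ∀ p ∈ T, ∀ q ∈ T, ‖p‖ ^ 2 - ‖q‖ ^ 2 ≤ D) :
    volume T ≤ ENNReal.ofReal (Real.pi * D) := by
  rcases T.eq_empty_or_nonempty with rfl | hne
  · simp
  set m : ℝ := sInf ((fun p : ℂ => ‖p‖ ^ 2) '' T) with hm
  have hbdd : BddBelow ((fun p : ℂ => ‖p‖ ^ 2) '' T) :=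
    ⟨0, by rintro _ ⟨p, -, rfl⟩; positivity⟩
  have hm0 : 0 ≤ m := Real.sInf_nonneg (by rintro _ ⟨p, -, rfl⟩; positivity)
  have hsub : T ⊆ Metric.closedBall (0 : ℂ) (√(m + D)) \ Metric.ball 0 (√m) := by
    intro p hp
    have h1 : m ≤ ‖p‖ ^ 2 := csInf_le hbdd ⟨p, hp, rfl⟩
    have h2 : ‖p‖ ^ 2 - D ≤ m := by
      refine le_csInf (hne.image _) ?_
      rintro _ ⟨q, hq, rfl⟩
      have := hT p hp q hq
      simp only
      linarith
    refine ⟨?_, ?_⟩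
    · rw [mem_closedBall_zero_iff]
      exact Real.le_sqrt_of_sq_le (by linarith)
    · rw [mem_ball_zero_iff, not_lt]
      exact Real.sqrt_le_iff.mpr ⟨norm_nonneg _, h1⟩
  refine (measure_mono hsub).trans ?_
  rw [measure_sdiff ((Metric.ball_subset_closedBall).trans
      (Metric.closedBall_subset_closedBall (Real.sqrt_le_sqrt (by linarith))))
      measurableSet_ball.nullMeasurableSet measure_ball_lt_top.ne,
    Complex.volume_closedBall, Complex.volume_ball, ← ENNReal.ofReal_pow (Real.sqrt_nonneg _),
    ← ENNReal.ofReal_pow (Real.sqrt_nonneg _), Real.sq_sqrt (by positivity), Real.sq_sqrt hm0,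
    ← ENNReal.ofReal_coe_nnreal, NNReal.coe_real_pi, ← ENNReal.ofReal_mul (by positivity),
    ← ENNReal.ofReal_mul hm0, ← ENNReal.ofReal_sub _ (by positivity)]
  exact ENNReal.ofReal_le_ofReal (by linarith)

/-- A difference of squares is at most the difference times a bound for the sum. -/
theorem le_mul_sub_of_sq_sub_sq {A A' N δ : ℝ} (hA : 0 ≤ A) (hA' : 0 ≤ A') (hAN : A ≤ N)
    (hAN' : A' ≤ N) (hδ : 0 < δ) (h : A' ^ 2 - A ^ 2 = δ) : δ ≤ 2 * N * (A' - A) := by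
  have h1 : 0 < A' - A := by
    by_contra! hle
    nlinarith
  nlinarith

theorem exists_linearIsometryEquiv_prod_complex (ξ : E3) :
    ∃ Ψ : E3 ≃ₗᵢ[ℝ] WithLp 2 (ℝ × ℂ), Ψ ξ = WithLp.toLp 2 (‖ξ‖, 0) := by
  have hfin : Module.finrank ℝ E3 = Module.finrank ℝ (WithLp 2 (ℝ × ℂ)) := by
    rw [(WithLp.linearEquiv 2 ℝ (ℝ × ℂ)).finrank_eq]
    simp
  let Ψ₀ : E3 ≃ₗᵢ[ℝ] WithLp 2 (ℝ × ℂ) :=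
    (stdOrthonormalBasis ℝ E3).equiv (stdOrthonormalBasis ℝ (WithLp 2 (ℝ × ℂ))) (finCongr hfin)
  have hnorm : ‖Ψ₀ ξ‖ = ‖WithLp.toLp 2 ((‖ξ‖, 0) : ℝ × ℂ)‖ := by
    rw [Ψ₀.norm_map, ← sq_eq_sq₀ (norm_nonneg _) (norm_nonneg _), WithLp.prod_norm_sq_eq_of_L2]
    simp
  exact ⟨Ψ₀.trans (ℝ ∙ (Ψ₀ ξ - WithLp.toLp 2 (‖ξ‖, 0)))ᗮ.reflection,
    by simpa using Submodule.reflection_sub hnorm⟩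

/-- The part of a thickened ellipsoid of revolution lying in a slab orthogonal to its axis. -/
def shellInSlab (z₀ d N r a L : ℝ) : Set (ℝ × ℂ) :=
  {p | |p.1 - z₀| ≤ r ∧ ‖WithLp.toLp 2 p‖ ≤ N ∧ ‖WithLp.toLp 2 ((d, 0) - p)‖ ≤ N ∧
    |‖WithLp.toLp 2 p‖ + ‖WithLp.toLp 2 ((d, 0) - p)‖ - a| ≤ L}

theorem isClosed_shellInSlab (z₀ d N r a L : ℝ) : IsClosed (shellInSlab z₀ d N r a L) := by
  have h1 : Continuous fun p : ℝ × ℂ => WithLp.toLp 2 p :=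
    (WithLp.prodContinuousLinearEquiv 2 ℝ ℝ ℂ).symm.continuous
  have h2 : Continuous fun p : ℝ × ℂ => WithLp.toLp 2 ((d, 0) - p) :=
    h1.comp (continuous_const.sub continuous_id)
  have h3 : Continuous fun p : ℝ × ℂ => |p.1 - z₀| := by fun_prop
  exact (isClosed_le h3 continuous_const).inter
    ((isClosed_le h1.norm continuous_const).inter
      ((isClosed_le h2.norm continuous_const).inter
        (isClosed_le ((h1.norm.add h2.norm).sub continuous_const).abs continuous_const)))

theorem volume_shellInSlab_le (z₀ d a : ℝ) {N r L : ℝ} (hN : 0 ≤ N) (hL : 0 ≤ L) :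
    volume (shellInSlab z₀ d N r a L) ≤ ENNReal.ofReal (4 * Real.pi * (r * N * L)) := by
  rw [Measure.volume_eq_prod, Measure.prod_apply (isClosed_shellInSlab ..).measurableSet]
  have hslice : ∀ z : ℝ, volume (Prod.mk z ⁻¹' shellInSlab z₀ d N r a L) ≤
      (Icc (z₀ - r) (z₀ + r)).indicator (fun _ => ENNReal.ofReal (Real.pi * (2 * L * N))) z := by
    intro z
    by_cases hz : z ∈ Icc (z₀ - r) (z₀ + r)
    · rw [indicator_of_mem hz]
      refine volume_le_of_norm_sq_sub_le (by positivity) ?_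
      rintro p ⟨-, hp1, hp2, hp3⟩ q ⟨-, hq1, hq2, hq3⟩
      rcases le_or_gt (‖p‖ ^ 2 - ‖q‖ ^ 2) 0 with hle | hlt
      · exact hle.trans (by positivity)
      have e1 : ‖WithLp.toLp 2 (z, p)‖ ^ 2 - ‖WithLp.toLp 2 (z, q)‖ ^ 2 = ‖p‖ ^ 2 - ‖q‖ ^ 2 := by
        simp [WithLp.prod_norm_sq_eq_of_L2]
      have e2 : ‖WithLp.toLp 2 ((d, 0) - (z, p))‖ ^ 2 - ‖WithLp.toLp 2 ((d, 0) - (z, q))‖ ^ 2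
          = ‖p‖ ^ 2 - ‖q‖ ^ 2 := by
        simp [WithLp.prod_norm_sq_eq_of_L2]
      have i1 := le_mul_sub_of_sq_sub_sq (norm_nonneg _) (norm_nonneg _) hq1 hp1 hlt e1
      have i2 := le_mul_sub_of_sq_sub_sq (norm_nonneg _) (norm_nonneg _) hq2 hp2 hlt e2
      rw [abs_le] at hp3 hq3
      nlinarith
    · rw [indicator_of_notMem hz, nonpos_iff_eq_zero]
      convert! measure_empty (μ := (volume : Measure ℂ))
      refine eq_empty_of_forall_notMem fun p hp => hz ?_
      have := abs_le.mp hp.1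
      constructor <;> simp only at this <;> linarith
  refine (lintegral_mono hslice).trans ?_
  rw [lintegral_indicator_const measurableSet_Icc, Real.volume_Icc,
    ← ENNReal.ofReal_mul (by positivity)]
  exact ENNReal.ofReal_le_ofReal (by linarith)

/-- Frequencies in a ball whose interaction with output frequency `ξ₀` is nearly resonant. -/
def resonantSet (ξ₀ x₀ : E3) (N r a L : ℝ) : Set E3 :=
  {ξ | ξ ∈ Metric.closedBall x₀ r ∧ ‖ξ‖ ≤ N ∧ ‖ξ₀ - ξ‖ ≤ N ∧ |‖ξ‖ + ‖ξ₀ - ξ‖ - a| ≤ L}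

theorem isClosed_resonantSet (ξ₀ x₀ : E3) (N r a L : ℝ) :
    IsClosed (resonantSet ξ₀ x₀ N r a L) := by
  have h1 : Continuous fun ξ : E3 => ‖ξ‖ := by fun_prop
  have h2 : Continuous fun ξ : E3 => ‖ξ₀ - ξ‖ := by fun_prop
  exact Metric.isClosed_closedBall.inter ((isClosed_le h1 continuous_const).inter
    ((isClosed_le h2 continuous_const).inter
      (isClosed_le ((h1.add h2).sub continuous_const).abs continuous_const)))

theorem volume_resonantSet_le (ξ₀ x₀ : E3) (a : ℝ) {N r L : ℝ} (hN : 0 ≤ N) (hL : 0 ≤ L) :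
    volume (resonantSet ξ₀ x₀ N r a L) ≤ ENNReal.ofReal (4 * Real.pi * (r * N * L)) := by
  obtain ⟨Ψ, hΨ⟩ := exists_linearIsometryEquiv_prod_complex ξ₀
  have hΦ : MeasurePreserving (fun ξ => WithLp.ofLp (Ψ ξ)) (volume : Measure E3) volume :=
    (WithLp.volume_preserving_ofLp ℝ ℂ).comp Ψ.measurePreserving
  refine le_trans ?_ (volume_shellInSlab_le (Ψ x₀).fst ‖ξ₀‖ a hN hL)
  rw [← hΦ.measure_preimage (isClosed_shellInSlab ..).measurableSet.nullMeasurableSet]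
  refine measure_mono ?_
  rintro ξ ⟨h1, h2, h3, h4⟩
  have hsub : ‖WithLp.toLp 2 ((‖ξ₀‖, 0) - WithLp.ofLp (Ψ ξ))‖ = ‖ξ₀ - ξ‖ := by
    rw [← Ψ.norm_map (ξ₀ - ξ), map_sub, hΨ]
    rfl
  have hid : ‖WithLp.toLp 2 (WithLp.ofLp (Ψ ξ))‖ = ‖ξ‖ := Ψ.norm_map ξ
  refine ⟨?_, ?_, ?_, ?_⟩
  · have h5 : ‖Ψ (ξ - x₀)‖ ≤ r := by
      rw [Ψ.norm_map, ← dist_eq_norm]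
      exact h1
    have h6 := WithLp.prod_norm_sq_eq_of_L2 (Ψ (ξ - x₀))
    have h7 : (Ψ (ξ - x₀)).fst = (Ψ ξ).fst - (Ψ x₀).fst := by
      rw [map_sub]
      rfl
    rw [h7, Real.norm_eq_abs] at h6
    refine le_trans ?_ h5
    refine abs_le_of_sq_le_sq' ?_ (norm_nonneg _) |> abs_le.mpr
    rw [h6, sq_abs]
    exact le_add_of_nonneg_right (by positivity)
  · rwa [hid]
  · rwa [hsub]
  · rwa [hid, hsub]

/-- A closed enlargement of the truncated thickened cone over a ball. -/
def coneOverBall (s N L r : ℝ) (x₀ : E3) : Set Spacetime :=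
  {X | X.2 ∈ Metric.closedBall x₀ r ∧ ‖X.2‖ ≤ N ∧ |(-X.1) + s * ‖X.2‖| ≤ L}

theorem isClosed_coneOverBall (s N L r : ℝ) (x₀ : E3) : IsClosed (coneOverBall s N L r x₀) := by
  have h1 : Continuous fun X : Spacetime => ‖X.2‖ := by fun_prop
  have h2 : Continuous fun X : Spacetime => |(-X.1) + s * ‖X.2‖| := by fun_prop
  exact (Metric.isClosed_closedBall.preimage continuous_snd).inter
    ((isClosed_le h1 continuous_const).inter (isClosed_le h2 continuous_const))

theorem volume_coneOverBall_inter_le {s N L r : ℝ} (hs : s = 1 ∨ s = -1) (hN : 0 ≤ N)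
    (hL : 0 ≤ L) (x₀ : E3) (Z : Spacetime) :
    volume {X | X ∈ coneOverBall s N L r x₀ ∧ Z - X ∈ coneOverBall s N L r x₀} ≤
      ENNReal.ofReal (16 * Real.pi * (r * N * L ^ 2)) := by
  set E := {X | X ∈ coneOverBall s N L r x₀ ∧ Z - X ∈ coneOverBall s N L r x₀} with hE
  have hcl : IsClosed E := (isClosed_coneOverBall s N L r x₀).inter
    ((isClosed_coneOverBall s N L r x₀).preimage (continuous_sub_left Z))
  rw [Measure.volume_eq_prod, Measure.prod_apply_symm hcl.measurableSet]
  have hslice : ∀ ξ : E3, volume ((fun τ : ℝ => (τ, ξ)) ⁻¹' E) ≤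
      (resonantSet Z.2 x₀ N r (s * Z.1) (2 * L)).indicator
        (fun _ => ENNReal.ofReal (2 * L)) ξ := by
    intro ξ
    by_cases hξ : ξ ∈ resonantSet Z.2 x₀ N r (s * Z.1) (2 * L)
    · rw [indicator_of_mem hξ]
      have hsub : (fun τ : ℝ => (τ, ξ)) ⁻¹' E ⊆ Icc (s * ‖ξ‖ - L) (s * ‖ξ‖ + L) := by
        rintro τ ⟨⟨-, -, h⟩, -⟩
        rw [abs_le] at h
        simp only at h
        constructor <;> linarith
      refine (measure_mono hsub).trans ?_
      rw [Real.volume_Icc]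
      exact ENNReal.ofReal_le_ofReal (by linarith)
    · rw [indicator_of_notMem hξ, nonpos_iff_eq_zero]
      convert! measure_empty (μ := (volume : Measure ℝ))
      refine eq_empty_of_forall_notMem fun τ hτ => hξ ?_
      obtain ⟨⟨h1, h2, h3⟩, -, h5, h6⟩ := hτ
      refine ⟨h1, h2, h5, ?_⟩
      simp only [Prod.fst_sub, Prod.snd_sub, abs_le] at h3 h6 ⊢
      rcases hs with rfl | rfl <;> constructor <;> linarith
  refine (lintegral_mono hslice).trans ?_
  rw [lintegral_indicator_const (isClosed_resonantSet ..).measurableSet]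
  refine (mul_le_mul_right (volume_resonantSet_le Z.2 x₀ (s * Z.1) hN
    (by positivity : 0 ≤ 2 * L)) _).trans ?_
  rw [← ENNReal.ofReal_mul (by positivity)]
  exact ENNReal.ofReal_le_ofReal (by linarith)

open FourierTransform Convolution in
/-- The `L²` norm of a self-convolution is controlled by the overlaps of the support with its
reflected translates. -/
theorem lintegral_enorm_convolution_sq_le {V : Type*} [NormedAddCommGroup V]
    [InnerProductSpace ℝ V] [FiniteDimensional ℝ V] [MeasurableSpace V] [BorelSpace V]
    {h : V → ℂ} (hc : Continuous h) {K : ℝ≥0∞}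
    (hK : ∀ z, volume {w | h w ≠ 0 ∧ h (z - w) ≠ 0} ≤ K) :
    ∫⁻ z, ‖(h ⋆[ContinuousLinearMap.mul ℂ ℂ] h) z‖ₑ ^ 2 ≤ K * (∫⁻ w, ‖h w‖ₑ ^ 2) ^ 2 := by
  have hpt : ∀ z, ‖(h ⋆[ContinuousLinearMap.mul ℂ ℂ] h) z‖ₑ ^ 2 ≤
      K * ∫⁻ w, ‖h w‖ₑ ^ 2 * ‖h (z - w)‖ₑ ^ 2 := by
    intro z
    set S : Set V := {w | h w ≠ 0 ∧ h (z - w) ≠ 0} with hS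
    have hSm : MeasurableSet S :=
      ((isOpen_ne_fun hc continuous_const).inter
        (isOpen_ne_fun (hc.comp (continuous_const.sub continuous_id))
          continuous_const)).measurableSet
    have hm : Measurable fun w => ‖h w‖ₑ * ‖h (z - w)‖ₑ :=
      (hc.enorm.measurable).mul (hc.comp (continuous_const.sub continuous_id)).enorm.measurable
    have h1 : ‖(h ⋆[ContinuousLinearMap.mul ℂ ℂ] h) z‖ₑ ≤
        ∫⁻ w, ((fun w => ‖h w‖ₑ * ‖h (z - w)‖ₑ) * S.indicator (1 : V → ℝ≥0∞)) w := by
      rw [convolution_def]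
      refine (enorm_integral_le_lintegral_enorm _).trans (lintegral_mono fun w => ?_)
      by_cases hw : w ∈ S
      · simp [hw, enorm_mul]
      · have : h w * h (z - w) = 0 := by
          by_contra hne
          exact hw ⟨left_ne_zero_of_mul hne, right_ne_zero_of_mul hne⟩
        simp [this]
    have h2 := ENNReal.lintegral_mul_le_Lp_mul_Lq volume
      (Real.HolderConjugate.two_two) hm.aemeasurable
      ((measurable_one.indicator hSm : Measurable (S.indicator (1 : V → ℝ≥0∞))).aemeasurable)
    have h3 : ∀ w, S.indicator (1 : V → ℝ≥0∞) w ^ (2 : ℝ) = S.indicator 1 w := by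
      intro w
      by_cases hw : w ∈ S <;> simp [hw]
    simp_rw [h3] at h2
    rw [lintegral_indicator_one hSm] at h2
    calc ‖(h ⋆[ContinuousLinearMap.mul ℂ ℂ] h) z‖ₑ ^ 2
        ≤ ((∫⁻ w, (‖h w‖ₑ * ‖h (z - w)‖ₑ) ^ (2 : ℝ)) ^ (1 / 2 : ℝ)
            * volume S ^ (1 / 2 : ℝ)) ^ 2 := by
          gcongr
          exact h1.trans h2
      _ = volume S * ∫⁻ w, (‖h w‖ₑ * ‖h (z - w)‖ₑ) ^ (2 : ℝ) := by
          rw [mul_pow, ← ENNReal.rpow_mul_natCast, ← ENNReal.rpow_mul_natCast]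
          norm_num
          rw [mul_comm]
      _ ≤ K * ∫⁻ w, ‖h w‖ₑ ^ 2 * ‖h (z - w)‖ₑ ^ 2 := by
          simp only [ENNReal.rpow_two, mul_pow]
          gcongr
          exact hK z
  refine (lintegral_mono hpt).trans ?_
  have hm2 : Measurable fun p : V × V => ‖h p.2‖ₑ ^ 2 * ‖h (p.1 - p.2)‖ₑ ^ 2 :=
    ((hc.comp continuous_snd).enorm.measurable.pow_const 2).mul
      ((hc.comp (continuous_fst.sub continuous_snd)).enorm.measurable.pow_const 2)
  rw [lintegral_const_mul _ hm2.lintegral_prod_right', lintegral_lintegral_swap hm2.aemeasurable]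
  gcongr
  have hsq : Measurable fun w => ‖h w‖ₑ ^ 2 := hc.enorm.measurable.pow_const 2
  have : ∀ w, ∫⁻ z, ‖h w‖ₑ ^ 2 * ‖h (z - w)‖ₑ ^ 2 = ‖h w‖ₑ ^ 2 * ∫⁻ z, ‖h z‖ₑ ^ 2 := by
    intro w
    rw [lintegral_const_mul _ (show Measurable fun z => ‖h (z - w)‖ₑ ^ 2 from
        hsq.comp (measurable_id.sub_const w)),
      lintegral_sub_right_eq_self (fun z => ‖h z‖ₑ ^ 2)]
  simp_rw [this]
  rw [lintegral_mul_const _ hsq, sq]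

theorem eLpNorm_natCast_pow {α F : Type*} [MeasurableSpace α] [NormedAddCommGroup F]
    (μ : Measure α) (f : α → F) {n : ℕ} (hn : n ≠ 0) :
    eLpNorm f n μ ^ n = ∫⁻ x, ‖f x‖ₑ ^ n ∂μ := by
  rw [eLpNorm_eq_lintegral_rpow_enorm_toReal (by exact_mod_cast hn) (by simp),
    ← ENNReal.rpow_mul_natCast]
  simp [hn]

section Fourier

open FourierTransform

variable {V : Type*} [NormedAddCommGroup V] [InnerProductSpace ℝ V] [FiniteDimensional ℝ V]
  [MeasurableSpace V] [BorelSpace V]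

theorem eLpNorm_two_fourier (f : SchwartzMap V ℂ) :
    eLpNorm (⇑(𝓕 f : SchwartzMap V ℂ)) 2 volume = eLpNorm (⇑f) 2 volume := by
  have h := SchwartzMap.norm_fourier_toL2_eq f
  rw [SchwartzMap.norm_toLp, SchwartzMap.norm_toLp] at h
  exact (ENNReal.toReal_eq_toReal_iff' ((𝓕 f).eLpNorm_lt_top 2 volume).ne
    (f.eLpNorm_lt_top 2 volume).ne).mp h

theorem eLpNorm_four_pow_le (v : SchwartzMap V ℂ) {K : ℝ≥0∞}
    (hK : ∀ z, volume {w | 𝓕⁻ v w ≠ 0 ∧ 𝓕⁻ v (z - w) ≠ 0} ≤ K) :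
    eLpNorm (⇑v) 4 volume ^ 4 ≤ K * eLpNorm (⇑v) 2 volume ^ 4 := by
  set h : SchwartzMap V ℂ := 𝓕⁻ v with hh
  have hv : 𝓕 h = v := by simp [hh]
  let B := ContinuousLinearMap.mul ℂ ℂ
  set g : SchwartzMap V ℂ := SchwartzMap.convolution B h h with hg
  have hgv : ∀ x, 𝓕 g x = v x * v x := by
    intro x
    rw [hg, SchwartzMap.fourier_convolution, hv]
    rfl
  have hgh : ∀ x, g x = MeasureTheory.convolution h h B volume x :=
    SchwartzMap.convolution_apply B h h
  have e2 : ∀ f : SchwartzMap V ℂ, eLpNorm (⇑f) 2 volume ^ 2 = ∫⁻ x, ‖f x‖ₑ ^ 2 := fun f => by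
    exact_mod_cast eLpNorm_natCast_pow volume (⇑f) two_ne_zero
  have e4 : eLpNorm (⇑v) 4 volume ^ 4 = ∫⁻ x, ‖v x‖ₑ ^ 4 := by
    exact_mod_cast eLpNorm_natCast_pow volume (⇑v) four_ne_zero
  calc eLpNorm (⇑v) 4 volume ^ 4 = ∫⁻ x, ‖𝓕 g x‖ₑ ^ 2 := by
        rw [e4]
        refine lintegral_congr fun x => ?_
        rw [hgv, enorm_mul]
        ring
    _ = ∫⁻ x, ‖g x‖ₑ ^ 2 := by rw [← e2, ← e2, eLpNorm_two_fourier]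
    _ ≤ K * (∫⁻ w, ‖h w‖ₑ ^ 2) ^ 2 := by
        simp_rw [hgh]
        exact lintegral_enorm_convolution_sq_le h.continuous hK
    _ = K * eLpNorm (⇑v) 2 volume ^ 4 := by
        rw [← e2, ← eLpNorm_two_fourier h, hv]
        ring

end Fourier

open FourierTransform in
theorem fourierInv_comp_ofLp_eq (u : Spacetime → ℂ) (w : WithLp 2 (ℝ × E3)) :
    𝓕⁻ (fun X : WithLp 2 (ℝ × E3) => u (WithLp.ofLp X)) w =
      spacetimeFT u ((-(2 * Real.pi)) • WithLp.ofLp w) := by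
  rw [Real.fourierInv_eq', spacetimeFT,
    ← (WithLp.volume_preserving_symm_measurableEquiv_toLp_prod ℝ E3).integral_comp']
  refine integral_congr_ae (Filter.Eventually.of_forall fun X => ?_)
  simp only [WithLp.prod_inner_apply, smul_eq_mul, MeasurableEquiv.coe_toLp_symm]
  congr 2
  simp only [Prod.smul_fst, Prod.smul_snd, inner_smul_right, smul_eq_mul, RCLike.inner_apply,
    conj_trivial]
  push_cast
  ring

/-- Klainerman–Tataru refinement of the frequency-localized Strichartz L⁴ estimate
(Theorem C:Thm). -/
theorem strichartz_L4_ball_refinement :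
    ∃ c ∈ Set.Ioo (0 : ℝ) 1, ∃ C > (0 : ℝ),
      ∀ (N L : ℝ), 0 < N → 0 < L →
      ∀ (s : ℝ), (s = 1 ∨ s = -1) →
      ∀ (r : ℝ) (x₀ : E3), 0 < r → r ≤ c * N →
      ∀ (u : SchwartzMap Spacetime ℂ),
        Function.support (spacetimeFT u)
          ⊆ cone s N L ∩ {X : Spacetime | X.2 ∈ Metric.closedBall x₀ r} →
      eLpNorm (⇑u) 4 volume
        ≤ ENNReal.ofReal (C * Real.sqrt (Real.sqrt (r * N) * L)) * eLpNorm (⇑u) 2 volume := by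
  refine ⟨1 / 2, by norm_num, 4, by norm_num, ?_⟩
  intro N L hN hL s hs r x₀ hr _ u hu
  let v : SchwartzMap (WithLp 2 (ℝ × E3)) ℂ :=
    SchwartzMap.compCLMOfContinuousLinearEquiv ℂ (WithLp.prodContinuousLinearEquiv 2 ℝ ℝ E3) u
  have : (volume : Measure Spacetime).IsAddHaarMeasure :=
    Measure.prod.instIsAddHaarMeasure (volume : Measure ℝ) (volume : Measure E3)
  have hmp := WithLp.volume_preserving_ofLp ℝ E3
  have hnorm : ∀ p : ℝ≥0∞, eLpNorm (⇑v) p volume = eLpNorm (⇑u) p volume := fun p =>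
    eLpNorm_comp_measurePreserving u.continuous.aestronglyMeasurable hmp
  have hsupp : ∀ w, FourierTransformInv.fourierInv v w ≠ 0 →
      (-(2 * Real.pi)) • WithLp.ofLp w ∈ coneOverBall s N L r x₀ := by
    intro w hw
    have hw' : spacetimeFT u ((-(2 * Real.pi)) • WithLp.ofLp w) ≠ 0 := by
      rw [← fourierInv_comp_ofLp_eq]
      rwa [SchwartzMap.fourierInv_coe] at hw
    obtain ⟨⟨-, h1, h2⟩, h3⟩ := hu hw'
    exact ⟨h3, h1, h2⟩
  have hπ : (1 : ℝ) ≤ 2 * Real.pi := by linarith [Real.pi_gt_three]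
  have hK : ∀ z, volume {w | FourierTransformInv.fourierInv v w ≠ 0 ∧
      FourierTransformInv.fourierInv v (z - w) ≠ 0} ≤
        ENNReal.ofReal (16 * Real.pi * (r * N * L ^ 2)) := by
    intro z
    set Z : Spacetime := (-(2 * Real.pi)) • WithLp.ofLp z
    set E : Set Spacetime :=
      {X | X ∈ coneOverBall s N L r x₀ ∧ Z - X ∈ coneOverBall s N L r x₀}
    have hsub : {w | FourierTransformInv.fourierInv v w ≠ 0 ∧
        FourierTransformInv.fourierInv v (z - w) ≠ 0} ⊆
          (MeasurableEquiv.toLp 2 (ℝ × E3)).symm ⁻¹' ((fun X => (-(2 * Real.pi)) • X) ⁻¹' E) := by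
      rintro w ⟨h1, h2⟩
      refine ⟨hsupp w h1, ?_⟩
      have := hsupp _ h2
      rwa [WithLp.ofLp_sub, smul_sub] at this
    refine (measure_mono hsub).trans ?_
    rw [(WithLp.volume_preserving_symm_measurableEquiv_toLp_prod ℝ E3).measure_preimage_equiv,
      Measure.addHaar_preimage_smul _ (by linarith)]
    refine le_trans ?_ (volume_coneOverBall_inter_le hs hN.le hL.le x₀ Z)
    refine mul_le_of_le_one_left zero_le (ENNReal.ofReal_le_one.mpr ?_)
    rw [abs_inv, abs_pow, abs_neg, abs_of_nonneg (by linarith)]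
    exact inv_le_one_of_one_le₀ (one_le_pow₀ hπ)
  rw [← hnorm, ← hnorm, ← ENNReal.pow_le_pow_left_iff four_ne_zero, mul_pow]
  refine (eLpNorm_four_pow_le v hK).trans ?_
  gcongr
  rw [← ENNReal.ofReal_pow (by positivity)]
  refine ENNReal.ofReal_le_ofReal ?_
  have h4 : (4 * √(√(r * N) * L)) ^ 4 = 256 * (r * N * L ^ 2) := by
    calc (4 * √(√(r * N) * L)) ^ 4 = 256 * ((√(√(r * N) * L)) ^ 2) ^ 2 := by ring
      _ = 256 * ((√(r * N)) ^ 2 * L ^ 2) := by rw [Real.sq_sqrt (by positivity), mul_pow]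
      _ = 256 * (r * N * L ^ 2) := by rw [Real.sq_sqrt (by positivity)]
  rw [h4]
  gcongr
  linarith [Real.pi_le_four]
end
end
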